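/- Let H be a tree of Eulerian graphs such that the number of negative edges remaining after deleting all bridges of H is even. Then H admits three weak signed circuit covers C1, C2, C3 of total width at most 4, such that each Ci individually has width at most 2, and C1 covers every negative loop of H exactly twice. -/

import Mathlib

open Finset
open scoped Classical

noncomputable section

namespace SignedCircuitCover

variable {V E : Type} [Fintype V] [Fintype E] [DecidableEq V] [DecidableEq E]

/-- `e` is a loop. -/
def IsLoop (ends : E → Sym2 V) (e : E) : Prop := (ends e).IsDiag

/-- The vertices incident with an edge of `F`. -/
def support (ends : E → Sym2 V) (F : Finset E) : Finset V :=
  Finset.univ.filter fun v => ∃ e ∈ F, v ∈ ends e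

/-- Degree of `v` in the subgraph with edge set `F` (a loop counts twice). -/
def degree (ends : E → Sym2 V) (F : Finset E) (v : V) : ℕ :=
  ∑ e ∈ F, (if ends e = Sym2.diag v then 2 else if v ∈ ends e then 1 else 0)

/-- Reachability inside the edge set `F`. -/
def Reach (ends : E → Sym2 V) (F : Finset E) : V → V → Prop :=
  Relation.ReflTransGen fun a b => ∃ e ∈ F, ends e = s(a, b)

/-- The subgraph with edge set `F` is connected. -/
def ConnectedOn (ends : E → Sym2 V) (F : Finset E) : Prop :=
  ∀ u ∈ support ends F, ∀ v ∈ support ends F, Reach ends F u v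

/-- The whole graph is connected. -/
def Connected (ends : E → Sym2 V) : Prop :=
  ∀ u v : V, Reach ends (Finset.univ : Finset E) u v

/-- `F` is the edge set of a circuit (connected, 2-regular; a loop is a circuit). -/
def IsCircuit (ends : E → Sym2 V) (F : Finset E) : Prop :=
  F.Nonempty ∧ ConnectedOn ends F ∧ ∀ v ∈ support ends F, degree ends F v = 2

/-- `F` is the edge set of an Eulerian subgraph (connected, all degrees even). -/
def IsEulerianOn (ends : E → Sym2 V) (F : Finset E) : Prop :=
  ConnectedOn ends F ∧ ∀ v ∈ support ends F, Even (degree ends F v)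

/-- Negative edges of `F` (`sgn e = true` means `e` is negative). -/
def negEdges (sgn : E → Bool) (F : Finset E) : Finset E := F.filter fun e => sgn e = true

def IsBalancedCircuit (ends : E → Sym2 V) (sgn : E → Bool) (F : Finset E) : Prop :=
  IsCircuit ends F ∧ Even (negEdges sgn F).card

def IsUnbalancedCircuit (ends : E → Sym2 V) (sgn : E → Bool) (F : Finset E) : Prop :=
  IsCircuit ends F ∧ Odd (negEdges sgn F).card

/-- `P` is the edge set of a path with (distinct) end-vertices `u` and `v`. -/
def IsPath (ends : E → Sym2 V) (P : Finset E) (u v : V) : Prop :=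
  P.Nonempty ∧ ConnectedOn ends P ∧ u ≠ v ∧
    u ∈ support ends P ∧ v ∈ support ends P ∧
    degree ends P u = 1 ∧ degree ends P v = 1 ∧
    ∀ w ∈ support ends P, w ≠ u → w ≠ v → degree ends P w = 2

/-- A short barbell: two unbalanced circuits meeting at exactly one vertex. -/
def IsShortBarbell (ends : E → Sym2 V) (sgn : E → Bool) (F : Finset E) : Prop :=
  ∃ C₁ C₂ : Finset E, Disjoint C₁ C₂ ∧ F = C₁ ∪ C₂ ∧
    IsUnbalancedCircuit ends sgn C₁ ∧ IsUnbalancedCircuit ends sgn C₂ ∧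
    ∃ v : V, support ends C₁ ∩ support ends C₂ = {v}

/-- A long barbell: two disjoint unbalanced circuits joined by a path meeting
them only at its end-vertices. -/
def IsLongBarbell (ends : E → Sym2 V) (sgn : E → Bool) (F : Finset E) : Prop :=
  ∃ (C₁ C₂ P : Finset E) (u v : V),
    Disjoint C₁ C₂ ∧ Disjoint C₁ P ∧ Disjoint C₂ P ∧ F = C₁ ∪ C₂ ∪ P ∧
    IsUnbalancedCircuit ends sgn C₁ ∧ IsUnbalancedCircuit ends sgn C₂ ∧
    Disjoint (support ends C₁) (support ends C₂) ∧
    IsPath ends P u v ∧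
    support ends P ∩ support ends C₁ = {u} ∧
    support ends P ∩ support ends C₂ = {v}

def IsBarbell (ends : E → Sym2 V) (sgn : E → Bool) (F : Finset E) : Prop :=
  IsShortBarbell ends sgn F ∨ IsLongBarbell ends sgn F

/-- A signed circuit: a balanced circuit, a short barbell or a long barbell. -/
def IsSignedCircuit (ends : E → Sym2 V) (sgn : E → Bool) (F : Finset E) : Prop :=
  IsBalancedCircuit ends sgn F ∨ IsShortBarbell ends sgn F ∨ IsLongBarbell ends sgn F

/-- `e` is a bridge (cut-edge) of the subgraph with edge set `F`. -/
def IsBridgeIn (ends : E → Sym2 V) (F : Finset E) (e : E) : Prop :=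
  e ∈ F ∧ ∀ a b : V, ends e = s(a, b) → ¬ Reach ends (F.erase e) a b

/-- The bridges of the whole graph. -/
def bridges (ends : E → Sym2 V) : Finset E :=
  Finset.univ.filter fun e => IsBridgeIn ends Finset.univ e

/-- The non-bridge edges of the whole graph. -/
def nonbridges (ends : E → Sym2 V) : Finset E := Finset.univ \ bridges ends

/-- Reachability inside `F` avoiding the vertex `x`. -/
def ReachAvoid (ends : E → Sym2 V) (F : Finset E) (x : V) : V → V → Prop :=
  Relation.ReflTransGen fun a b => a ≠ x ∧ b ≠ x ∧ ∃ e ∈ F, ends e = s(a, b)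

/-- `x` is a cut-vertex of the subgraph with edge set `F`. -/
def IsCutVertexOn (ends : E → Sym2 V) (F : Finset E) (x : V) : Prop :=
  ∃ a ∈ support ends F, ∃ b ∈ support ends F,
    a ≠ x ∧ b ≠ x ∧ Reach ends F a b ∧ ¬ ReachAvoid ends F x a b

/-- The subgraph with edge set `F` is 2-connected (connected and without cut-vertices). -/
def TwoConnectedOn (ends : E → Sym2 V) (F : Finset E) : Prop :=
  ConnectedOn ends F ∧ ∀ x : V, ¬ IsCutVertexOn ends F x

/-- The whole graph is 2-connected. -/
def TwoConnected (ends : E → Sym2 V) : Prop :=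
  Connected ends ∧ ∀ x : V, ¬ IsCutVertexOn ends (Finset.univ : Finset E) x

/-- Total length of a collection of subgraphs. -/
def totalLength (𝒞 : List (Finset E)) : ℕ := (𝒞.map Finset.card).sum

/-- The width of the edge `e` with respect to the collection `𝒞`. -/
def widthAt (𝒞 : List (Finset E)) (e : E) : ℕ := (𝒞.filter fun C => e ∈ C).length

/-- `𝒞` covers every edge of the graph. -/
def CoversAll (𝒞 : List (Finset E)) : Prop := ∀ e : E, ∃ C ∈ 𝒞, e ∈ C

/-- A tree of Eulerian graphs: connected, and after deleting all bridges every
component is Eulerian (equivalently all degrees in the bridgeless part are even). -/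
def IsTreeOfEulerian (ends : E → Sym2 V) : Prop :=
  Connected ends ∧ ∀ v : V, Even (degree ends (nonbridges ends) v)

/-- Non-bridge non-loop edges. -/
def nbnl (ends : E → Sym2 V) : Finset E :=
  (nonbridges ends).filter fun e => ¬ IsLoop ends e

/-- A tree of circuits: connected, and after deleting all bridges and loops every
vertex has degree 0 or 2 (each component is an isolated vertex or a circuit). -/
def IsTreeOfCircuits (ends : E → Sym2 V) : Prop :=
  Connected ends ∧
    ∀ v : V, degree ends (nbnl ends) v = 0 ∨ degree ends (nbnl ends) v = 2

/-- The balloon containing `v`: the edge set of the component of `v` in the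
graph of non-bridge non-loop edges. -/
def compBalloon (ends : E → Sym2 V) (v : V) : Finset E :=
  (nbnl ends).filter fun e => ∃ w ∈ ends e, Reach ends (nbnl ends) v w

/-- Valency of the balloon of `v`: the number of bridges and loops incident
with its component. -/
def balloonValency (ends : E → Sym2 V) (v : V) : ℕ :=
  (Finset.univ.filter fun e =>
    (IsBridgeIn ends Finset.univ e ∨ IsLoop ends e) ∧
      ∃ w ∈ ends e, Reach ends (nbnl ends) v w).card

/-- A balloon consisting of a single negative loop. -/
def IsNegLoopBalloon (ends : E → Sym2 V) (sgn : E → Bool) (B : Finset E) : Prop :=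
  ∃ e : E, IsLoop ends e ∧ sgn e = true ∧ B = {e}

/-- A leaf balloon: a negative loop, or a nontrivial balloon of valency 1. -/
def IsLeafBalloon (ends : E → Sym2 V) (sgn : E → Bool) (B : Finset E) : Prop :=
  IsNegLoopBalloon ends sgn B ∨
    ∃ v : V, B = compBalloon ends v ∧ B.Nonempty ∧ balloonValency ends v = 1

/-- A leaf circuit: a negative loop, or a balloon of valency 1 which is a circuit. -/
def IsLeafCircuit (ends : E → Sym2 V) (sgn : E → Bool) (B : Finset E) : Prop :=
  IsNegLoopBalloon ends sgn B ∨
    ∃ v : V, B = compBalloon ends v ∧ IsCircuit ends B ∧ balloonValency ends v = 1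

/-- An inner circuit: a balloon of valency at least 2 which is a circuit. -/
def IsInnerCircuit (ends : E → Sym2 V) (B : Finset E) : Prop :=
  ∃ v : V, B = compBalloon ends v ∧ IsCircuit ends B ∧ 2 ≤ balloonValency ends v

/-- Number of unbalanced circuits of a tree of circuits: negative loops together
with the unbalanced (nontrivial) balloons. -/
def numUnbalancedCircuits (ends : E → Sym2 V) (sgn : E → Bool) : ℕ :=
  (Finset.univ.filter fun e : E => IsLoop ends e ∧ sgn e = true).card +
    Set.ncard {B : Finset E |
      (∃ v : V, B = compBalloon ends v) ∧ B.Nonempty ∧ Odd (negEdges sgn B).card}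

/-- Flow-admissibility: every edge lies in a signed circuit (Bouchet). -/
def FlowAdmissible (ends : E → Sym2 V) (sgn : E → Bool) : Prop :=
  ∀ e : E, ∃ C : Finset E, IsSignedCircuit ends sgn C ∧ e ∈ C

/-- `e` has exactly one end-vertex in `U`. -/
def crosses (ends : E → Sym2 V) (U : Finset V) (e : E) : Prop :=
  ∃ a b : V, ends e = s(a, b) ∧ ((a ∈ U ∧ b ∉ U) ∨ (a ∉ U ∧ b ∈ U))

/-- Switching the signature at the vertex set `U`. -/
def switch (ends : E → Sym2 V) (U : Finset V) (sgn : E → Bool) : E → Bool :=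
  fun e => if crosses ends U e then ! (sgn e) else sgn e

/-- The number of negative edges of a signature. -/
def negCount (sgn : E → Bool) : ℕ := (Finset.univ.filter fun e => sgn e = true).card

/-- `sgn` is a minimum signature: no equivalent (switched) signature has fewer
negative edges. -/
def IsMinSignature (ends : E → Sym2 V) (sgn : E → Bool) : Prop :=
  ∀ U : Finset V, negCount sgn ≤ negCount (switch ends U sgn)

/-- `{e₁, e₂}` is a 2-edge-cut of the subgraph with edge set `F`. -/
def IsTwoEdgeCut (ends : E → Sym2 V) (F : Finset E) (e₁ e₂ : E) : Prop :=
  e₁ ≠ e₂ ∧ e₁ ∈ F ∧ e₂ ∈ F ∧ ¬ IsBridgeIn ends F e₁ ∧ ¬ IsBridgeIn ends F e₂ ∧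
    (∀ a b : V, ends e₁ = s(a, b) → ¬ Reach ends ((F.erase e₁).erase e₂) a b) ∧
    (∀ a b : V, ends e₂ = s(a, b) → ¬ Reach ends ((F.erase e₁).erase e₂) a b)

/-- `b` is a bridge of `F` whose removal leaves two parts which are both unbalanced. -/
def SeparatesUnbalanced (ends : E → Sym2 V) (sgn : E → Bool) (F : Finset E) (b : E) : Prop :=
  IsBridgeIn ends F b ∧
    ∀ a c : V, ends b = s(a, c) →
      (∃ C ⊆ F.erase b, IsUnbalancedCircuit ends sgn C ∧
        ∃ w ∈ support ends C, Reach ends (F.erase b) a w) ∧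
      (∃ C ⊆ F.erase b, IsUnbalancedCircuit ends sgn C ∧
        ∃ w ∈ support ends C, Reach ends (F.erase b) c w)

/-- `T` is a spanning tree of the whole graph: spanning, connected and acyclic. -/
def IsSpanningTree (ends : E → Sym2 V) (T : Finset E) : Prop :=
  (∀ u v : V, Reach ends T u v) ∧ ∀ C ⊆ T, ¬ IsCircuit ends C

set_option linter.unusedSectionVars false
set_option linter.unusedVariables false


/-! ### Basic tools -/

theorem mem_supp {ends : E → Sym2 V} {F : Finset E} {v : V} :
    v ∈ support ends F ↔ ∃ e ∈ F, v ∈ ends e := by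
  simp [support]

theorem supp_mono {ends : E → Sym2 V} {F G : Finset E} (h : F ⊆ G) :
    support ends F ⊆ support ends G := by
  intro v hv
  rw [mem_supp] at *
  obtain ⟨e, he, hv⟩ := hv
  exact ⟨e, h he, hv⟩

theorem supp_union {ends : E → Sym2 V} {F G : Finset E} :
    support ends (F ∪ G) = support ends F ∪ support ends G := by
  ext v
  simp only [mem_supp, Finset.mem_union]
  constructor
  · rintro ⟨e, he | he, hv⟩
    · exact Or.inl ⟨e, he, hv⟩
    · exact Or.inr ⟨e, he, hv⟩
  · rintro (⟨e, he, hv⟩ | ⟨e, he, hv⟩)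
    · exact ⟨e, Or.inl he, hv⟩
    · exact ⟨e, Or.inr he, hv⟩

/-- contribution of an edge to a degree -/
def inc (ends : E → Sym2 V) (e : E) (v : V) : ℕ :=
  if ends e = Sym2.diag v then 2 else if v ∈ ends e then 1 else 0

theorem degree_eq (ends : E → Sym2 V) (F : Finset E) (v : V) :
    degree ends F v = ∑ e ∈ F, inc ends e v := rfl

theorem inc_eq {ends : E → Sym2 V} {e : E} {a b : V} (h : ends e = s(a, b)) (v : V) :
    inc ends e v = (if v = a then 1 else 0) + (if v = b then 1 else 0) := by
  unfold inc
  rw [h]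
  have : Sym2.diag v = s(v, v) := rfl
  rw [this]
  simp only [Sym2.eq_iff, Sym2.mem_iff]
  split_ifs <;> first | rfl | (exfalso; grind)

theorem exists_ends (ends : E → Sym2 V) (e : E) : ∃ a b, ends e = s(a, b) := by
  induction h : ends e using Sym2.ind with
  | _ a b => exact ⟨a, b, rfl⟩

theorem inc_pos {ends : E → Sym2 V} {e : E} {v : V} : inc ends e v ≠ 0 ↔ v ∈ ends e := by
  obtain ⟨a, b, h⟩ := exists_ends ends e
  rw [inc_eq h, h, Sym2.mem_iff]
  split_ifs <;> simp_all

theorem degree_zero {ends : E → Sym2 V} {F : Finset E} {v : V} :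
    degree ends F v = 0 ↔ v ∉ support ends F := by
  rw [degree_eq, Finset.sum_eq_zero_iff, mem_supp]
  push Not
  refine forall_congr' fun e => forall_congr' fun _ => ?_
  rw [← not_iff_not]
  push Not
  exact inc_pos

theorem degree_union {ends : E → Sym2 V} {F G : Finset E} (h : Disjoint F G) (v : V) :
    degree ends (F ∪ G) v = degree ends F v + degree ends G v := by
  simp only [degree_eq]
  exact Finset.sum_union h

theorem degree_sdiff {ends : E → Sym2 V} {F G : Finset E} (h : G ⊆ F) (v : V) :
    degree ends (F \ G) v + degree ends G v = degree ends F v := by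
  simp only [degree_eq]
  exact Finset.sum_sdiff h

theorem degree_mono {ends : E → Sym2 V} {F G : Finset E} (h : G ⊆ F) (v : V) :
    degree ends G v ≤ degree ends F v := by
  have := degree_sdiff (ends := ends) h v
  omega

theorem degree_insert {ends : E → Sym2 V} {F : Finset E} {e : E} {a b : V}
    (h : ends e = s(a, b)) (he : e ∉ F) (v : V) :
    degree ends (insert e F) v =
      (if v = a then 1 else 0) + (if v = b then 1 else 0) + degree ends F v := by
  simp only [degree_eq]
  rw [Finset.sum_insert he, inc_eq h]

theorem reach_mono {ends : E → Sym2 V} {F G : Finset E} (h : F ⊆ G) {u v : V}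
    (hr : Reach ends F u v) : Reach ends G u v := by
  induction hr with
  | refl => exact Relation.ReflTransGen.refl
  | tail _ h' ih =>
    obtain ⟨e, he, hab⟩ := h'
    exact ih.tail ⟨e, h he, hab⟩

theorem reach_symm {ends : E → Sym2 V} {F : Finset E} {u v : V}
    (hr : Reach ends F u v) : Reach ends F v u := by
  induction hr with
  | refl => exact Relation.ReflTransGen.refl
  | tail _ h ih =>
    obtain ⟨e, he, hab⟩ := h
    exact Relation.ReflTransGen.head ⟨e, he, by rw [hab, Sym2.eq_swap]⟩ ih

theorem reach_trans {ends : E → Sym2 V} {F : Finset E} {u v w : V}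
    (h1 : Reach ends F u v) (h2 : Reach ends F v w) : Reach ends F u w :=
  Relation.ReflTransGen.trans h1 h2

theorem reach_edge {ends : E → Sym2 V} {F : Finset E} {e : E} (he : e ∈ F) {u v : V}
    (hu : u ∈ ends e) (hv : v ∈ ends e) : Reach ends F u v := by
  obtain ⟨a, b, h⟩ := exists_ends ends e
  rw [h, Sym2.mem_iff] at hu hv
  have hab : Reach ends F a b := Relation.ReflTransGen.single ⟨e, he, h⟩
  rcases hu with rfl | rfl <;> rcases hv with rfl | rfl
  · exact Relation.ReflTransGen.refl
  · exact hab
  · exact reach_symm hab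
  · exact Relation.ReflTransGen.refl

theorem reach_closed {ends : E → Sym2 V} {F : Finset E} {u v : V} (S : V → Prop)
    (hS : ∀ e ∈ F, ∀ a b, ends e = s(a, b) → S a → S b)
    (hr : Reach ends F u v) (hu : S u) : S v := by
  induction hr with
  | refl => exact hu
  | tail _ h ih =>
    obtain ⟨e, he, hab⟩ := h
    exact hS e he _ _ hab ih

theorem reach_supp {ends : E → Sym2 V} {F : Finset E} {u v : V}
    (hr : Reach ends F u v) : u = v ∨ (u ∈ support ends F ∧ v ∈ support ends F) := by
  induction hr with
  | refl => exact Or.inl rfl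
  | tail _ h ih =>
    obtain ⟨e, he, hab⟩ := h
    right
    refine ⟨?_, mem_supp.2 ⟨e, he, by rw [hab]; simp⟩⟩
    rcases ih with rfl | ih
    · exact mem_supp.2 ⟨e, he, by rw [hab]; simp⟩
    · exact ih.1

theorem handshake {ends : E → Sym2 V} {F : Finset E} (W : Finset V)
    (hW : ∀ e ∈ F, ∀ a b, ends e = s(a, b) → (a ∈ W ↔ b ∈ W)) :
    Even (∑ v ∈ W, degree ends F v) := by
  simp only [degree_eq]
  rw [Finset.sum_comm]
  refine Finset.even_sum _ fun e he => ?_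
  obtain ⟨a, b, h⟩ := exists_ends ends e
  have := hW e he a b h
  simp only [inc_eq h, Finset.sum_add_distrib, Finset.sum_ite_eq']
  by_cases ha : a ∈ W
  · simp [ha, this.1 ha]
  · simp [ha, mt this.2 ha]

theorem odd_reach {ends : E → Sym2 V} {Z : Finset E} {u : V} (hu : Odd (degree ends Z u)) :
    ∃ v, v ≠ u ∧ Odd (degree ends Z v) ∧ Reach ends Z u v := by
  by_contra hcon
  push Not at hcon
  have h := handshake (ends := ends) (F := Z) (Finset.univ.filter fun w => Reach ends Z u w) (by
    intro e he a b hab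
    have h1 : Reach ends Z a b := Relation.ReflTransGen.single ⟨e, he, hab⟩
    simp only [Finset.mem_filter, Finset.mem_univ, true_and]
    exact ⟨fun h => reach_trans h h1, fun h => reach_trans h (reach_symm h1)⟩)
  have hmem : u ∈ (Finset.univ.filter fun w => Reach ends Z u w) := by
    simp only [Finset.mem_filter, Finset.mem_univ, true_and]
    exact Relation.ReflTransGen.refl
  rw [← Finset.add_sum_erase _ _ hmem] at h
  have h2 : Even (∑ x ∈ (Finset.univ.filter fun w => Reach ends Z u w).erase u,
      degree ends Z x) := by
    refine Finset.even_sum _ fun w hw => ?_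
    simp only [Finset.mem_erase, Finset.mem_filter, Finset.mem_univ, true_and] at hw
    by_contra hne
    exact hcon w hw.1 (Nat.not_even_iff_odd.1 hne) hw.2
  exact Nat.not_even_iff_odd.2 (hu.add_even h2) h

/-- Simple paths, with edge set and vertex set. -/
inductive SP (ends : E → Sym2 V) : Finset E → Finset V → V → V → Prop
  | nil (u : V) : SP ends ∅ {u} u u
  | cons {P : Finset E} {S : Finset V} {a b v : V} (e : E) : ends e = s(a, b) → a ∉ S →
      SP ends P S b v → SP ends (insert e P) (insert a S) a v

theorem SP.left_mem {ends : E → Sym2 V} {P S u v} (h : SP ends P S u v) : u ∈ S := by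
  cases h <;> simp

theorem SP.right_mem {ends : E → Sym2 V} {P S u v} (h : SP ends P S u v) : v ∈ S := by
  induction h with
  | nil => simp
  | cons e _ _ _ ih => simp [ih]

theorem SP.ends_sub {ends : E → Sym2 V} {P S u v} (h : SP ends P S u v) :
    ∀ e ∈ P, ∀ w ∈ ends e, w ∈ S := by
  induction h with
  | nil => simp
  | cons e he ha h ih =>
    intro f hf w hw
    rcases Finset.mem_insert.1 hf with rfl | hf
    · rw [he, Sym2.mem_iff] at hw
      rcases hw with rfl | rfl
      · simp
      · simp [h.left_mem]
    · simp [ih f hf w hw]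

theorem SP.supp_sub {ends : E → Sym2 V} {P S u v} (h : SP ends P S u v) :
    support ends P ⊆ S := by
  intro w hw
  obtain ⟨e, he, hw⟩ := mem_supp.1 hw
  exact h.ends_sub e he w hw

theorem SP.deg {ends : E → Sym2 V} {P S u v} (h : SP ends P S u v) (w : V) :
    degree ends P w + (if w = u then 1 else 0) + (if w = v then 1 else 0) =
      if w ∈ S then 2 else 0 := by
  induction h with
  | nil u =>
    simp only [degree_eq]
    by_cases hw : w = u <;> simp [hw]
  | @cons P S a b v e he ha h ih =>
    have heP : e ∉ P := fun hP => ha (h.ends_sub e hP a (by rw [he]; simp))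
    rw [degree_insert he heP]
    have h1 := h.left_mem
    have h2 := h.right_mem
    simp only [Finset.mem_insert]
    split_ifs at ih ⊢ <;> first | omega | (exfalso; grind)

theorem SP.reach {ends : E → Sym2 V} {P S u v} (h : SP ends P S u v) :
    ∀ w ∈ S, Reach ends P u w := by
  induction h with
  | nil u => intro w hw; rw [Finset.mem_singleton] at hw; subst hw; exact Relation.ReflTransGen.refl
  | @cons P S a b v e he ha h ih =>
    intro w hw
    rcases Finset.mem_insert.1 hw with rfl | hw
    · exact Relation.ReflTransGen.refl
    · exact Relation.ReflTransGen.head ⟨e, by simp, he⟩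
        (reach_mono (Finset.subset_insert _ _) (ih w hw))

theorem SP.supp_eq {ends : E → Sym2 V} {P S u v} (h : SP ends P S u v) (huv : u ≠ v) :
    support ends P = S := by
  refine Finset.Subset.antisymm h.supp_sub fun w hw => ?_
  by_contra hn
  have h0 := degree_zero.2 hn
  have := h.deg w
  rw [h0, if_pos hw] at this
  split_ifs at this with h1 h2 <;> first | omega | exact huv (h1.symm.trans h2)

theorem SP.nonempty {ends : E → Sym2 V} {P S u v} (h : SP ends P S u v) (huv : u ≠ v) :
    P.Nonempty := by
  cases h with
  | nil => exact absurd rfl huv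
  | cons => simp

theorem SP.isPath {ends : E → Sym2 V} {P S u v} (h : SP ends P S u v) (huv : u ≠ v) :
    IsPath ends P u v := by
  have hs := h.supp_eq huv
  refine ⟨h.nonempty huv, ?_, huv, ?_, ?_, ?_, ?_, ?_⟩
  · intro a ha b hb
    rw [hs] at ha hb
    exact reach_trans (reach_symm (h.reach a ha)) (h.reach b hb)
  · rw [hs]; exact h.left_mem
  · rw [hs]; exact h.right_mem
  · have := h.deg u
    simp [h.left_mem, huv] at this; omega
  · have := h.deg v
    simp [h.right_mem, huv.symm] at this; omega
  · intro w hw h1 h2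
    rw [hs] at hw
    have := h.deg w
    simpa [hw, h1, h2] using this

theorem SP.append {ends : E → Sym2 V} {P S u w} (h : SP ends P S u w) :
    ∀ {Q T v}, SP ends Q T w v → S ∩ T ⊆ {w} → SP ends (P ∪ Q) (S ∪ T) u v := by
  induction h with
  | nil u =>
    intro Q T v h2 _
    have : insert u T = T := Finset.insert_eq_of_mem h2.left_mem
    simpa [← Finset.insert_eq, this] using h2
  | @cons P S a b w e he ha h ih =>
    intro Q T v h2 hST
    have := ih h2 (fun x hx => hST (by
      simp only [Finset.mem_inter, Finset.mem_insert] at *; exact ⟨Or.inr hx.1, hx.2⟩))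
    rw [Finset.insert_union, Finset.insert_union]
    refine SP.cons e he ?_ this
    rw [Finset.mem_union]
    rintro (h3 | h3)
    · exact ha h3
    · have := hST (show a ∈ insert a S ∩ T by simp [h3])
      rw [Finset.mem_singleton] at this
      subst this
      exact ha h.right_mem

theorem SP.symm {ends : E → Sym2 V} {P S u v} (h : SP ends P S u v) : SP ends P S v u := by
  induction h with
  | nil u => exact SP.nil u
  | @cons P S a b v e he ha h ih =>
    have hba : b ≠ a := fun hh => ha (hh ▸ h.left_mem)
    have h1 : SP ends {e} {b, a} b a := by
      have := SP.cons (ends := ends) e (by rw [he, Sym2.eq_swap]) (by simpa using hba) (SP.nil a)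
      simpa using this
    have := ih.append h1 (by
      intro x hx
      simp only [Finset.mem_inter, Finset.mem_insert, Finset.mem_singleton] at *
      rcases hx with ⟨hx, rfl | rfl⟩
      · rfl
      · exact absurd hx ha)
    have e1 : P ∪ {e} = insert e P := by rw [Finset.union_comm]; rfl
    have e2 : S ∪ {b, a} = insert a S := by
      have := h.left_mem
      ext x; simp only [Finset.mem_union, Finset.mem_insert, Finset.mem_singleton]
      grind
    rwa [e1, e2] at this

theorem SP.split {ends : E → Sym2 V} {P S u v} (h : SP ends P S u v) :
    ∀ w ∈ S, ∃ P₁ S₁ P₂ S₂, SP ends P₁ S₁ u w ∧ SP ends P₂ S₂ w v ∧ Disjoint P₁ P₂ ∧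
      P = P₁ ∪ P₂ ∧ S = S₁ ∪ S₂ ∧ S₁ ∩ S₂ = {w} := by
  induction h with
  | nil u =>
    intro w hw
    rw [Finset.mem_singleton] at hw; subst hw
    exact ⟨∅, {w}, ∅, {w}, SP.nil w, SP.nil w, by simp, by simp, by simp, by simp⟩
  | @cons P S a b v e he ha h ih =>
    intro w hw
    have heP : e ∉ P := fun hP => ha (h.ends_sub e hP a (by rw [he]; simp))
    rcases Finset.mem_insert.1 hw with rfl | hw
    · refine ⟨∅, {w}, insert e P, insert w S, SP.nil w, SP.cons e he ha h, by simp, by simp,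
        by simp, Finset.singleton_inter_of_mem (by simp)⟩
    · obtain ⟨P₁, S₁, P₂, S₂, h1, h2, hd, rfl, rfl, hi⟩ := ih w hw
      refine ⟨insert e P₁, insert a S₁, P₂, S₂,
        SP.cons e he (fun hh => ha (by simp [hh])) h1, h2, ?_, ?_, ?_, ?_⟩
      · rw [Finset.disjoint_insert_left]
        exact ⟨fun hh => heP (by simp [hh]), hd⟩
      · rw [Finset.insert_union]
      · rw [Finset.insert_union]
      · rw [Finset.insert_inter_of_notMem (fun hh => ha (by simp [hh])), hi]

theorem SP.of_reach {ends : E → Sym2 V} {F : Finset E} {u v : V} (hr : Reach ends F u v) :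
    ∃ P S, P ⊆ F ∧ SP ends P S u v := by
  induction hr using Relation.ReflTransGen.head_induction_on with
  | refl => exact ⟨∅, {v}, by simp, SP.nil v⟩
  | @head a b h _ ih =>
    obtain ⟨e, he, hab⟩ := h
    obtain ⟨P, S, hP, hs⟩ := ih
    by_cases ha : a ∈ S
    · obtain ⟨P₁, S₁, P₂, S₂, h1, h2, hd, rfl, rfl, hi⟩ := hs.split a ha
      exact ⟨P₂, S₂, (Finset.subset_union_right).trans hP, h2⟩
    · exact ⟨_, _, Finset.insert_subset he hP, SP.cons e hab ha hs⟩

theorem conn_touch {ends : E → Sym2 V} {A B : Finset E} (hc : ConnectedOn ends (A ∪ B))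
    (hA : A.Nonempty) (hB : B.Nonempty) : ∃ v, v ∈ support ends A ∧ v ∈ support ends B := by
  by_contra hcon
  push Not at hcon
  obtain ⟨a, ha⟩ := hA
  obtain ⟨b, hb⟩ := hB
  obtain ⟨x, x', hx⟩ := exists_ends ends a
  obtain ⟨y, y', hy⟩ := exists_ends ends b
  have hxA : x ∈ support ends A := mem_supp.2 ⟨a, ha, by rw [hx]; simp⟩
  have hyB : y ∈ support ends B := mem_supp.2 ⟨b, hb, by rw [hy]; simp⟩
  have hr := hc x (supp_mono Finset.subset_union_left hxA) y
    (supp_mono Finset.subset_union_right hyB)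
  have := reach_closed (fun v => v ∈ support ends A) (by
    intro e he p q hpq hp
    rcases Finset.mem_union.1 he with he | he
    · exact mem_supp.2 ⟨e, he, by rw [hpq]; simp⟩
    · exact absurd (mem_supp.2 ⟨e, he, by rw [hpq]; simp⟩) (hcon p hp)) hr hxA
  exact hcon y this hyB

theorem conn_union {ends : E → Sym2 V} {A B : Finset E} (hA : ConnectedOn ends A)
    (hB : ConnectedOn ends B) {v : V} (h1 : v ∈ support ends A) (h2 : v ∈ support ends B) :
    ConnectedOn ends (A ∪ B) := by
  have key : ∀ x ∈ support ends (A ∪ B), Reach ends (A ∪ B) x v := by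
    intro x hx
    rw [supp_union, Finset.mem_union] at hx
    rcases hx with hx | hx
    · exact reach_mono Finset.subset_union_left (hA x hx v h1)
    · exact reach_mono Finset.subset_union_right (hB x hx v h2)
  intro x hx y hy
  exact reach_trans (key x hx) (reach_symm (key y hy))

theorem conn_single {ends : E → Sym2 V} (e : E) : ConnectedOn ends {e} := by
  intro x hx y hy
  obtain ⟨f, hf, hx'⟩ := mem_supp.1 hx
  obtain ⟨g, hg, hy'⟩ := mem_supp.1 hy
  rw [Finset.mem_singleton] at hf hg
  rw [hf] at hx'
  rw [hg] at hy'
  exact reach_edge (by simp) hx' hy'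

/-- connected component (edge set) of `v` in `F` -/
def comp (ends : E → Sym2 V) (F : Finset E) (v : V) : Finset E :=
  F.filter fun e => ∃ w ∈ ends e, Reach ends F v w

theorem comp_sub {ends : E → Sym2 V} {F : Finset E} {v : V} : comp ends F v ⊆ F :=
  Finset.filter_subset _ _

theorem comp_supp {ends : E → Sym2 V} {F : Finset E} {v w : V}
    (hw : w ∈ support ends (comp ends F v)) : Reach ends F v w := by
  obtain ⟨e, he, hw⟩ := mem_supp.1 hw
  obtain ⟨he, x, hx, hr⟩ := Finset.mem_filter.1 he
  exact reach_trans hr (reach_edge he hx hw)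

theorem mem_comp {ends : E → Sym2 V} {F : Finset E} {v w : V} {e : E} (he : e ∈ F)
    (hw : w ∈ ends e) (hr : Reach ends F v w) : e ∈ comp ends F v :=
  Finset.mem_filter.2 ⟨he, w, hw, hr⟩

theorem comp_reach {ends : E → Sym2 V} {F : Finset E} {v w : V}
    (hr : Reach ends F v w) : Reach ends (comp ends F v) v w := by
  induction hr with
  | refl => exact Relation.ReflTransGen.refl
  | @tail b c h1 h ih =>
    obtain ⟨e, he, hab⟩ := h
    exact ih.tail ⟨e, mem_comp he (by rw [hab]; simp) h1, hab⟩

theorem comp_conn {ends : E → Sym2 V} {F : Finset E} {v : V} :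
    ConnectedOn ends (comp ends F v) := by
  intro x hx y hy
  exact reach_trans (reach_symm (comp_reach (comp_supp hx))) (comp_reach (comp_supp hy))

theorem comp_closed {ends : E → Sym2 V} {F : Finset E} {v w : V} {e : E} (he : e ∈ F)
    (hw : w ∈ ends e) (hs : w ∈ support ends (comp ends F v)) : e ∈ comp ends F v :=
  mem_comp he hw (comp_supp hs)

/-- all degrees even -/
def EvenOn (ends : E → Sym2 V) (F : Finset E) : Prop := ∀ v, Even (degree ends F v)

theorem EvenOn.sdiff {ends : E → Sym2 V} {F G : Finset E} (hF : EvenOn ends F)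
    (hG : EvenOn ends G) (h : G ⊆ F) : EvenOn ends (F \ G) := by
  intro v
  have := degree_sdiff (ends := ends) h v
  have h1 := hF v
  rw [← this] at h1
  exact (Nat.even_add.1 h1).2 (hG v)

theorem EvenOn.comp {ends : E → Sym2 V} {F : Finset E} (hF : EvenOn ends F) (v : V) :
    EvenOn ends (comp ends F v) := by
  intro w
  by_cases hw : w ∈ support ends (SignedCircuitCover.comp ends F v)
  · have h := degree_sdiff (ends := ends) (comp_sub (ends := ends) (F := F) (v := v)) w
    have h0 : degree ends (F \ SignedCircuitCover.comp ends F v) w = 0 := by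
      rw [degree_zero]
      intro hs
      obtain ⟨e, he, hwe⟩ := mem_supp.1 hs
      rw [Finset.mem_sdiff] at he
      exact he.2 (comp_closed he.1 hwe hw)
    rw [h0, zero_add] at h
    rw [h]; exact hF w
  · rw [degree_zero.2 hw]; simp

theorem IsCircuit.evenOn {ends : E → Sym2 V} {C : Finset E} (h : IsCircuit ends C) :
    EvenOn ends C := by
  intro v
  by_cases hv : v ∈ support ends C
  · rw [h.2.2 v hv]; simp
  · rw [degree_zero.2 hv]; simp

theorem IsCircuit.deg_le {ends : E → Sym2 V} {C : Finset E} (h : IsCircuit ends C) (v : V) :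
    degree ends C v ≤ 2 := by
  by_cases hv : v ∈ support ends C
  · rw [h.2.2 v hv]
  · rw [degree_zero.2 hv]; simp

theorem IsCircuit.sub_eq {ends : E → Sym2 V} {C D : Finset E} (hC : IsCircuit ends C)
    (hD : IsCircuit ends D) (h : D ⊆ C) : D = C := by
  by_contra hne
  have hn : (C \ D).Nonempty := by
    rw [Finset.nonempty_iff_ne_empty]
    intro h0
    exact hne (Finset.Subset.antisymm h (Finset.sdiff_eq_empty_iff_subset.1 h0))
  obtain ⟨v, h1, h2⟩ := conn_touch (ends := ends) (A := D) (B := C \ D)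
    (by rw [Finset.union_sdiff_of_subset h]; exact hC.2.1) hD.1 hn
  have := degree_sdiff (ends := ends) h v
  have h3 := hD.2.2 v h1
  have h4 := hC.deg_le v
  have h5 := mt degree_zero.1 (not_not.2 h2)
  omega

theorem circuit_of_paths {ends : E → Sym2 V} {P Q : Finset E} {S T : Finset V} {u v : V}
    (hP : SP ends P S u v) (hQ : SP ends Q T u v) (huv : u ≠ v) (hd : Disjoint P Q)
    (hST : S ∩ T ⊆ {u, v}) : IsCircuit ends (P ∪ Q) := by
  refine ⟨(hP.nonempty huv).mono Finset.subset_union_left, ?_, ?_⟩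
  · exact conn_union (hP.isPath huv).2.1 (hQ.isPath huv).2.1
      (v := u) (by rw [hP.supp_eq huv]; exact hP.left_mem) (by rw [hQ.supp_eq huv]; exact hQ.left_mem)
  · intro w hw
    rw [supp_union, hP.supp_eq huv, hQ.supp_eq huv, Finset.mem_union] at hw
    rw [degree_union hd]
    have h1 := hP.deg w
    have h2 := hQ.deg w
    have h3 : w ∈ S → w ∈ T → w = u ∨ w = v := fun a b => by
      simpa using hST (Finset.mem_inter.2 ⟨a, b⟩)
    have := hP.left_mem
    have := hP.right_mem
    have := hQ.left_mem
    have := hQ.right_mem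
    split_ifs at h1 h2 <;> first | omega | (exfalso; grind)

/-- two vertices of odd degree are connected by a path -/
theorem join_reach {ends : E → Sym2 V} {Z : Finset E} {u v : V}
    (hu : Odd (degree ends Z u)) (h : ∀ w, w ≠ u → w ≠ v → Even (degree ends Z w)) :
    Reach ends Z u v := by
  obtain ⟨w, hw, ho, hr⟩ := odd_reach hu
  by_cases hwv : w = v
  · exact hwv ▸ hr
  · exact absurd (h w hw hwv) (Nat.not_even_iff_odd.2 ho)

/-- complement of a path in an even graph -/
theorem reach_compl {ends : E → Sym2 V} {Z P : Finset E} {S : Finset V} {u v : V}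
    (hZ : EvenOn ends Z) (hP : SP ends P S u v) (huv : u ≠ v) (hPZ : P ⊆ Z) :
    Reach ends (Z \ P) u v := by
  have hd := fun w => degree_sdiff (ends := ends) hPZ w
  apply join_reach
  · have h1 := hP.deg u
    have h2 := hd u
    have h3 := hZ u
    simp only [hP.left_mem, if_true, huv, if_false] at h1
    rw [← Nat.not_even_iff_odd]
    intro h4
    rw [← h2] at h3
    have := (Nat.even_add.1 h3).1 h4
    rw [show degree ends P u = 1 by omega] at this
    exact absurd this (by decide)
  · intro w h1 h2
    have h3 := hP.deg w
    simp only [h1, h2, if_false, add_zero] at h3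
    have h4 := hZ w
    rw [← hd w] at h4
    refine (Nat.even_add.1 h4).2 ?_
    rw [h3]; split_ifs <;> decide

theorem circuit_arcs {ends : E → Sym2 V} {C : Finset E} (hC : IsCircuit ends C) {y z : V}
    (hy : y ∈ support ends C) (hz : z ∈ support ends C) (hyz : y ≠ z) :
    ∃ P S Q T, SP ends P S y z ∧ SP ends Q T y z ∧ Disjoint P Q ∧ P ∪ Q = C ∧ S ∩ T = {y, z} := by
  obtain ⟨P, S, hPC, hP⟩ := SP.of_reach (hC.2.1 y hy z hz)
  obtain ⟨Q, T, hQC, hQ⟩ := SP.of_reach (reach_compl hC.evenOn hP hyz hPC)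
  have hd : Disjoint P Q := by
    rw [Finset.disjoint_left]; intro e he hq
    exact (Finset.mem_sdiff.1 (hQC hq)).2 he
  have hsub : P ∪ Q ⊆ C := Finset.union_subset hPC (hQC.trans Finset.sdiff_subset)
  have hST : S ∩ T ⊆ {y, z} := by
    intro w hw
    rw [Finset.mem_inter] at hw
    by_contra hn
    simp only [Finset.mem_insert, Finset.mem_singleton, not_or] at hn
    have h1 := hP.deg w
    have h2 := hQ.deg w
    have h3 := degree_union (ends := ends) hd w
    have h4 := degree_mono (ends := ends) hsub w
    have h5 := hC.deg_le w
    simp only [hw.1, hw.2, hn.1, hn.2, if_true, if_false] at h1 h2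
    omega
  refine ⟨P, S, Q, T, hP, hQ, hd, hC.sub_eq (circuit_of_paths hP hQ hyz hd hST) hsub, ?_⟩
  refine Finset.Subset.antisymm hST ?_
  intro w hw
  simp only [Finset.mem_insert, Finset.mem_singleton] at hw
  rcases hw with rfl | rfl
  · exact Finset.mem_inter.2 ⟨hP.left_mem, hQ.left_mem⟩
  · exact Finset.mem_inter.2 ⟨hP.right_mem, hQ.right_mem⟩

theorem loop_circuit {ends : E → Sym2 V} {e : E} {v : V} (h : ends e = s(v, v)) :
    IsCircuit ends {e} := by
  refine ⟨by simp, conn_single e, ?_⟩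
  intro w hw
  obtain ⟨f, hf, hw'⟩ := mem_supp.1 hw
  rw [Finset.mem_singleton] at hf
  rw [hf, h] at hw'
  have : w = v := by simpa using hw'
  rw [degree_eq, Finset.sum_singleton, inc_eq h, if_pos this]

/-- every edge of an even graph is in a circuit -/
theorem exists_circuit {ends : E → Sym2 V} {Z : Finset E} (hZ : EvenOn ends Z) {e : E}
    (he : e ∈ Z) : ∃ C ⊆ Z, IsCircuit ends C ∧ e ∈ C := by
  obtain ⟨a, b, hab⟩ := exists_ends ends e
  by_cases h : a = b
  · subst h
    exact ⟨{e}, by simpa using he, loop_circuit hab, by simp⟩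
  · have hs : SP ends {e} {a, b} a b := by
      have := SP.cons (ends := ends) e hab (by simpa using h) (SP.nil b)
      simpa using this
    obtain ⟨Q, T, hQC, hQ⟩ := SP.of_reach (reach_compl hZ hs h (by simpa using he))
    refine ⟨{e} ∪ Q, ?_, circuit_of_paths hs hQ h ?_ Finset.inter_subset_left, by simp⟩
    · exact Finset.union_subset (by simpa using he) (hQC.trans Finset.sdiff_subset)
    · rw [Finset.disjoint_left]; intro f hf hq
      exact (Finset.mem_sdiff.1 (hQC hq)).2 hf


/-! ### Theta graphs and removable circuits -/

theorem zmod2_three : ∀ a b c : ZMod 2, a + b = 0 ∨ a + c = 0 ∨ b + c = 0 := by decide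

theorem T3 {ends : E → Sym2 V} (w : E → ZMod 2) : ∀ (n : ℕ) (G₁ G₂ G₃ : Finset E) (y z : V),
    G₁.card + G₂.card + G₃.card ≤ n → y ≠ z → Disjoint G₁ G₂ → Disjoint G₁ G₃ → Disjoint G₂ G₃ →
    Reach ends G₁ y z → Reach ends G₂ y z → Reach ends G₃ y z →
    ∃ A ⊆ G₁ ∪ G₂ ∪ G₃, IsCircuit ends A ∧ ∑ e ∈ A, w e = 0 := by
  intro n
  induction n with
  | zero =>
    intro G₁ G₂ G₃ y z hn hyz _ _ _ h1 _ _
    obtain ⟨P, S, hP, hs⟩ := SP.of_reach h1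
    have := Finset.card_pos.2 ((hs.nonempty hyz).mono hP)
    omega
  | succ n ih =>
    intro G₁ G₂ G₃ y z hn hyz h12 h13 h23 h1 h2 h3
    obtain ⟨P₁, S₁, hP1, hs1⟩ := SP.of_reach h1
    obtain ⟨P₂, S₂, hP2, hs2⟩ := SP.of_reach h2
    obtain ⟨P₃, S₃, hP3, hs3⟩ := SP.of_reach h3
    have c1 := Finset.card_le_card hP1
    have c2 := Finset.card_le_card hP2
    have c3 := Finset.card_le_card hP3
    have d12 := Finset.disjoint_of_subset_left hP1 (Finset.disjoint_of_subset_right hP2 h12)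
    have d13 := Finset.disjoint_of_subset_left hP1 (Finset.disjoint_of_subset_right hP3 h13)
    have d23 := Finset.disjoint_of_subset_left hP2 (Finset.disjoint_of_subset_right hP3 h23)
    have hsub : P₁ ∪ P₂ ∪ P₃ ⊆ G₁ ∪ G₂ ∪ G₃ :=
      Finset.union_subset_union (Finset.union_subset_union hP1 hP2) hP3
    have step : ∀ (A₁ A₂ A₃ : Finset E) (T₁ T₂ T₃ : Finset V), SP ends A₁ T₁ y z →
        SP ends A₂ T₂ y z → SP ends A₃ T₃ y z → Disjoint A₁ A₂ → Disjoint A₁ A₃ →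
        Disjoint A₂ A₃ → A₁.card + A₂.card + A₃.card ≤ n + 1 →
        (∃ x, x ∈ T₁ ∧ x ∈ T₂ ∧ x ≠ y ∧ x ≠ z) →
        ∃ A ⊆ A₁ ∪ A₂ ∪ A₃, IsCircuit ends A ∧ ∑ e ∈ A, w e = 0 := by
      rintro A₁ A₂ A₃ T₁ T₂ T₃ k1 k2 k3 e12 e13 e23 hc ⟨x, hx1, hx2, hxy, hxz⟩
      obtain ⟨Q₁, U₁, R₁, W₁, q1, r1, hd1, rfl, -, -⟩ := k1.split x hx1
      obtain ⟨Q₂, U₂, R₂, W₂, q2, r2, hd2, rfl, -, -⟩ := k2.split x hx2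
      have hR1 := Finset.card_pos.2 (r1.nonempty hxz)
      rw [Finset.card_union_of_disjoint hd1, Finset.card_union_of_disjoint hd2] at hc
      have hcu := Finset.card_union_le A₃ R₂
      simp only [Finset.disjoint_union_left, Finset.disjoint_union_right] at e12 e13 e23
      obtain ⟨A, hA, hA2⟩ := ih Q₁ Q₂ (A₃ ∪ R₂) y x (by omega) (Ne.symm hxy) e12.1.1
        (Finset.disjoint_union_right.2 ⟨e13.1, e12.2.1⟩)
        (Finset.disjoint_union_right.2 ⟨e23.1, hd2⟩)
        (q1.reach x q1.right_mem) (q2.reach x q2.right_mem)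
        (reach_trans (reach_mono Finset.subset_union_left (k3.reach z k3.right_mem))
          (reach_mono Finset.subset_union_right (reach_symm (r2.reach z r2.right_mem))))
      refine ⟨A, hA.trans ?_, hA2⟩
      intro e he
      simp only [Finset.mem_union] at *
      tauto
    by_cases i12 : ∃ x, x ∈ S₁ ∧ x ∈ S₂ ∧ x ≠ y ∧ x ≠ z
    · obtain ⟨A, hA, hA2⟩ := step P₁ P₂ P₃ S₁ S₂ S₃ hs1 hs2 hs3 d12 d13 d23 (by omega) i12
      exact ⟨A, hA.trans hsub, hA2⟩
    by_cases i13 : ∃ x, x ∈ S₁ ∧ x ∈ S₃ ∧ x ≠ y ∧ x ≠ z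
    · obtain ⟨A, hA, hA2⟩ := step P₁ P₃ P₂ S₁ S₃ S₂ hs1 hs3 hs2 d13 d12 d23.symm (by omega) i13
      exact ⟨A, (hA.trans (by intro e he; simp only [Finset.mem_union] at *; tauto)).trans hsub, hA2⟩
    by_cases i23 : ∃ x, x ∈ S₂ ∧ x ∈ S₃ ∧ x ≠ y ∧ x ≠ z
    · obtain ⟨A, hA, hA2⟩ := step P₂ P₃ P₁ S₂ S₃ S₁ hs2 hs3 hs1 d23 d12.symm d13.symm (by omega) i23
      exact ⟨A, (hA.trans (by intro e he; simp only [Finset.mem_union] at *; tauto)).trans hsub, hA2⟩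
    have inter : ∀ S T : Finset V, (¬ ∃ x, x ∈ S ∧ x ∈ T ∧ x ≠ y ∧ x ≠ z) → S ∩ T ⊆ {y, z} := by
      intro S T h x hx
      rw [Finset.mem_inter] at hx
      by_contra hn
      simp only [Finset.mem_insert, Finset.mem_singleton, not_or] at hn
      exact h ⟨x, hx.1, hx.2, hn⟩
    rcases zmod2_three (∑ e ∈ P₁, w e) (∑ e ∈ P₂, w e) (∑ e ∈ P₃, w e) with h | h | h
    · refine ⟨P₁ ∪ P₂, Finset.Subset.trans ?_ hsub, circuit_of_paths hs1 hs2 hyz d12 (inter _ _ i12), ?_⟩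
      · intro e he; simp only [Finset.mem_union] at *; tauto
      · rw [Finset.sum_union d12, h]
    · refine ⟨P₁ ∪ P₃, Finset.Subset.trans ?_ hsub, circuit_of_paths hs1 hs3 hyz d13 (inter _ _ i13), ?_⟩
      · intro e he; simp only [Finset.mem_union] at *; tauto
      · rw [Finset.sum_union d13, h]
    · refine ⟨P₂ ∪ P₃, Finset.Subset.trans ?_ hsub, circuit_of_paths hs2 hs3 hyz d23 (inter _ _ i23), ?_⟩
      · intro e he; simp only [Finset.mem_union] at *; tauto
      · rw [Finset.sum_union d23, h]

/-- no separation of order at most one -/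
def Tight (ends : E → Sym2 V) (K : Finset E) : Prop :=
  ∀ K₁ ⊆ K, K₁.Nonempty → (K \ K₁).Nonempty →
    ∃ y z, y ≠ z ∧ y ∈ support ends K₁ ∧ z ∈ support ends K₁ ∧
      y ∈ support ends (K \ K₁) ∧ z ∈ support ends (K \ K₁)

/-- a component of the complement of a circuit attaches at two vertices -/
theorem attach {ends : E → Sym2 V} {K B : Finset E} (hT : Tight ends K)
    (hBK : B ⊆ K) (hB : IsCircuit ends B) {e₀ : E} (he₀ : e₀ ∈ K \ B) {x : V} (hx : x ∈ ends e₀) :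
    ∃ y z, y ≠ z ∧ y ∈ support ends (comp ends (K \ B) x) ∧
      z ∈ support ends (comp ends (K \ B) x) ∧ y ∈ support ends B ∧ z ∈ support ends B := by
  have hsub : comp ends (K \ B) x ⊆ K \ B := comp_sub
  have hm : e₀ ∈ comp ends (K \ B) x := mem_comp he₀ hx Relation.ReflTransGen.refl
  obtain ⟨y, z, hyz, hy1, hz1, hy2, hz2⟩ := hT (comp ends (K \ B) x)
    (hsub.trans Finset.sdiff_subset) ⟨e₀, hm⟩ (by
      obtain ⟨b, hb⟩ := hB.1
      exact ⟨b, Finset.mem_sdiff.2 ⟨hBK hb, fun h => (Finset.mem_sdiff.1 (hsub h)).2 hb⟩⟩)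
  have key : ∀ y, y ∈ support ends (comp ends (K \ B) x) →
      y ∈ support ends (K \ comp ends (K \ B) x) → y ∈ support ends B := by
    intro y h1 h2
    obtain ⟨f, hf, hy⟩ := mem_supp.1 h2
    rw [Finset.mem_sdiff] at hf
    by_cases hfB : f ∈ B
    · exact mem_supp.2 ⟨f, hfB, hy⟩
    · exact absurd (comp_closed (Finset.mem_sdiff.2 ⟨hf.1, hfB⟩) hy h1) hf.2
  exact ⟨y, z, hyz, hy1, hz1, key y hy1 hy2, key z hz1 hz2⟩

theorem claimZ {ends : E → Sym2 V} (w : E → ZMod 2) {K : Finset E} (hne : K.Nonempty)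
    (hK : EvenOn ends K) (hT : Tight ends K) :
    ∃ A ⊆ K, IsCircuit ends A ∧ ConnectedOn ends (K \ A) ∧ (∑ e ∈ A, w e = 0 ∨ A = K) := by
  by_cases hcirc : IsCircuit ends K
  · refine ⟨K, Finset.Subset.refl _, hcirc, ?_, Or.inr rfl⟩
    intro u hu
    simp [support] at hu
  -- a balanced circuit
  have hex : ∃ B ⊆ K, IsCircuit ends B ∧ ∑ e ∈ B, w e = 0 := by
    obtain ⟨e, he⟩ := hne
    obtain ⟨C, hCK, hC, -⟩ := exists_circuit hK he
    have hn : (K \ C).Nonempty := by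
      rw [Finset.nonempty_iff_ne_empty]
      intro h0
      have := Finset.Subset.antisymm hCK (Finset.sdiff_eq_empty_iff_subset.1 h0)
      exact hcirc (this ▸ hC)
    obtain ⟨e₀, he₀⟩ := hn
    obtain ⟨x, x', hx⟩ := exists_ends ends e₀
    obtain ⟨y, z, hyz, hy1, hz1, hy2, hz2⟩ := attach hT hCK hC he₀ (x := x) (by rw [hx]; simp)
    obtain ⟨P, S, Q, T, hP, hQ, hd, hPQ, -⟩ := circuit_arcs hC hy2 hz2 hyz
    have hdis : Disjoint C (comp ends (K \ C) x) :=
      Finset.disjoint_of_subset_right comp_sub Finset.disjoint_sdiff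
    obtain ⟨A, hA, hA2⟩ := T3 w _ P Q (comp ends (K \ C) x) y z le_rfl hyz hd
      (Finset.disjoint_of_subset_left (by rw [← hPQ]; exact Finset.subset_union_left) hdis) (by
        exact Finset.disjoint_of_subset_left (by rw [← hPQ]; exact Finset.subset_union_right) hdis)
      (hP.reach z hP.right_mem) (hQ.reach z hQ.right_mem) (comp_conn y hy1 z hz1)
    refine ⟨A, hA.trans ?_, hA2⟩
    rw [hPQ]
    refine Finset.union_subset hCK (comp_sub.trans Finset.sdiff_subset)
  -- choose the pair
  let good : Finset (Finset E × Finset E) := Finset.univ.filter fun p =>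
    p.1 ⊆ K ∧ IsCircuit ends p.1 ∧ ∑ e ∈ p.1, w e = 0 ∧ p.2 ⊆ K \ p.1 ∧ ConnectedOn ends p.2
  have hgood : good.Nonempty := by
    obtain ⟨B, h1, h2, h3⟩ := hex
    refine ⟨(B, ∅), ?_⟩
    simp only [good, Finset.mem_filter, Finset.mem_univ, true_and]
    refine ⟨h1, h2, h3, by simp, ?_⟩
    intro u hu
    simp [support] at hu
  obtain ⟨⟨B, J⟩, hBJ, hmax⟩ := Finset.exists_max_image good (fun p => p.2.card) hgood
  simp only [good, Finset.mem_filter, Finset.mem_univ, true_and] at hBJ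
  obtain ⟨hBK, hB, hBw, hJ, hJc⟩ := hBJ
  have hmax' : ∀ B' J', B' ⊆ K → IsCircuit ends B' → ∑ e ∈ B', w e = 0 → J' ⊆ K \ B' →
      ConnectedOn ends J' → J'.card ≤ J.card := by
    intro B' J' h1 h2 h3 h4 h5
    exact hmax (B', J') (by
      simp only [good, Finset.mem_filter, Finset.mem_univ, true_and]
      exact ⟨h1, h2, h3, h4, h5⟩)
  by_cases hJe : J = K \ B
  · exact ⟨B, hBK, hB, hJe ▸ hJc, Or.inl hBw⟩
  exfalso
  obtain ⟨e₀, he₀, he₀J⟩ : ∃ e₀ ∈ K \ B, e₀ ∉ J := by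
    by_contra hcon
    push Not at hcon
    exact hJe (Finset.Subset.antisymm hJ hcon)
  have hJne : J.Nonempty := by
    have := hmax' B {e₀} hBK hB hBw (by simpa using he₀) (conn_single e₀)
    rw [Finset.card_singleton] at this
    exact Finset.card_pos.1 this
  obtain ⟨b, hb⟩ := hB.1
  have hKJ : (K \ J).Nonempty :=
    ⟨b, Finset.mem_sdiff.2 ⟨hBK hb, fun h => (Finset.mem_sdiff.1 (hJ h)).2 hb⟩⟩
  obtain ⟨t, -, -, ht1, -, ht2, -⟩ := hT J (hJ.trans Finset.sdiff_subset) hJne hKJ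
  obtain ⟨e, he, hte⟩ := mem_supp.1 ht2
  rw [Finset.mem_sdiff] at he
  have hJe' : ConnectedOn ends (J ∪ {e}) :=
    conn_union hJc (conn_single e) ht1 (mem_supp.2 ⟨e, by simp, hte⟩)
  have hcard : (J ∪ {e}).card = J.card + 1 := by
    rw [Finset.card_union_of_disjoint (by simpa using he.2)]; simp
  have heB : e ∈ B := by
    by_contra hn
    have := hmax' B (J ∪ {e}) hBK hB hBw (Finset.union_subset hJ (by
      simpa using ⟨he.1, hn⟩)) hJe'
    omega
  obtain ⟨x, x', hx⟩ := exists_ends ends e₀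
  have hxe : x ∈ ends e₀ := by rw [hx]; simp
  have hm : e₀ ∈ comp ends (K \ B) x := mem_comp he₀ hxe Relation.ReflTransGen.refl
  obtain ⟨y, z, hyz, hy1, hz1, hy2, hz2⟩ := attach hT hBK hB he₀ hxe
  have hev : EvenOn ends (comp ends (K \ B) x) := (hK.sdiff hB.evenOn hBK).comp x
  have hcn : ConnectedOn ends (comp ends (K \ B) x) := comp_conn
  have hcs : comp ends (K \ B) x ⊆ K \ B := comp_sub
  generalize comp ends (K \ B) x = H at *
  have hJH : ∀ a, a ∈ support ends J → a ∉ support ends H := by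
    intro a h1 h2
    have := hmax' B (J ∪ H) hBK hB hBw (Finset.union_subset hJ hcs) (conn_union hJc hcn h1 h2)
    have h3 : J ⊂ J ∪ H := by
      rw [Finset.ssubset_iff_of_subset Finset.subset_union_left]
      exact ⟨e₀, by simp [hm], he₀J⟩
    have := Finset.card_lt_card h3
    omega
  have hJHd : Disjoint J H := by
    rw [Finset.disjoint_left]
    intro f h1 h2
    obtain ⟨p, q, hpq⟩ := exists_ends ends f
    exact hJH p (mem_supp.2 ⟨f, h1, by rw [hpq]; simp⟩) (mem_supp.2 ⟨f, h2, by rw [hpq]; simp⟩)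
  have hty : t ≠ y := fun h => hJH t ht1 (h ▸ hy1)
  have htz : t ≠ z := fun h => hJH t ht1 (h ▸ hz1)
  obtain ⟨R, U, hR, htU, hRB⟩ : ∃ R U, SP ends R U y z ∧ t ∉ U ∧ R ⊆ B := by
    obtain ⟨P, S, Q, T, hP, hQ, hd, hPQ, hST⟩ := circuit_arcs hB hy2 hz2 hyz
    by_cases htS : t ∈ S
    · refine ⟨Q, T, hQ, ?_, by rw [← hPQ]; exact Finset.subset_union_right⟩
      intro htT
      have : t ∈ ({y, z} : Finset V) := by rw [← hST]; exact Finset.mem_inter.2 ⟨htS, htT⟩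
      simp [hty, htz] at this
    · exact ⟨P, S, hP, htS, by rw [← hPQ]; exact Finset.subset_union_left⟩
  obtain ⟨Q, T, hQH, hQ⟩ := SP.of_reach (hcn y hy1 z hz1)
  have hBH : Disjoint B H := Finset.disjoint_of_subset_right hcs Finset.disjoint_sdiff
  have hRH : Disjoint R H := Finset.disjoint_of_subset_left hRB hBH
  obtain ⟨B', hB's, hB'c, hB'w⟩ := T3 w _ R Q (H \ Q) y z le_rfl hyz
    (Finset.disjoint_of_subset_right hQH hRH)
    (Finset.disjoint_of_subset_right Finset.sdiff_subset hRH)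
    Finset.disjoint_sdiff
    (hR.reach z hR.right_mem) (hQ.reach z hQ.right_mem) (reach_compl hev hQ hyz hQH)
  have hB'' : ∀ f ∈ B', f ∈ R ∨ f ∈ H := by
    intro f hf
    have := hB's hf
    simp only [Finset.mem_union, Finset.mem_sdiff] at this
    rcases this with (h | h) | h
    · exact Or.inl h
    · exact Or.inr (hQH h)
    · exact Or.inr h.1
  have := hmax' B' (J ∪ {e}) (by
      intro f hf
      rcases hB'' f hf with h | h
      · exact hBK (hRB h)
      · exact (Finset.mem_sdiff.1 (hcs h)).1) hB'c hB'w (by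
      intro f hf
      rw [Finset.mem_sdiff]
      rw [Finset.mem_union, Finset.mem_singleton] at hf
      rcases hf with hf | rfl
      · refine ⟨(Finset.mem_sdiff.1 (hJ hf)).1, fun h => ?_⟩
        rcases hB'' f h with h | h
        · exact (Finset.mem_sdiff.1 (hJ hf)).2 (hRB h)
        · exact Finset.disjoint_left.1 hJHd hf h
      · refine ⟨he.1, fun h => ?_⟩
        rcases hB'' f h with h | h
        · exact htU (hR.ends_sub f h t hte)
        · exact Finset.disjoint_left.1 hBH heB h) hJe'
  omega


/-! ### Widths, covers, chains of barbells -/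

theorem widthAt_nil (e : E) : widthAt ([] : List (Finset E)) e = 0 := rfl

theorem widthAt_cons (C : Finset E) (L : List (Finset E)) (e : E) :
    widthAt (C :: L) e = (if e ∈ C then 1 else 0) + widthAt L e := by
  unfold widthAt
  rw [List.filter_cons]
  by_cases h : e ∈ C <;> simp [h]; omega

theorem widthAt_append (L L' : List (Finset E)) (e : E) :
    widthAt (L ++ L') e = widthAt L e + widthAt L' e := by
  simp [widthAt]

theorem widthAt_zero {L : List (Finset E)} {e : E} (h : ∀ C ∈ L, e ∉ C) : widthAt L e = 0 := by
  unfold widthAt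
  rw [List.length_eq_zero_iff, List.filter_eq_nil_iff]
  intro C hC
  simpa using h C hC

theorem widthAt_pos {L : List (Finset E)} {e : E} (h : 1 ≤ widthAt L e) : ∃ C ∈ L, e ∈ C := by
  by_contra hcon
  push Not at hcon
  rw [widthAt_zero hcon] at h
  omega

/-- three covers of the edges of `N` by signed circuits inside `F` -/
def Cov (ends : E → Sym2 V) (sgn : E → Bool) (N F : Finset E) : Prop :=
  ∃ C₁ C₂ C₃ : List (Finset E),
    (∀ C ∈ C₁, IsSignedCircuit ends sgn C ∧ C ⊆ F) ∧
    (∀ C ∈ C₂, IsSignedCircuit ends sgn C ∧ C ⊆ F) ∧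
    (∀ C ∈ C₃, IsSignedCircuit ends sgn C ∧ C ⊆ F) ∧
    (∀ e ∈ N, 1 ≤ widthAt C₁ e ∧ 1 ≤ widthAt C₂ e ∧ 1 ≤ widthAt C₃ e) ∧
    (∀ e, widthAt C₁ e ≤ 2 ∧ widthAt C₂ e ≤ 2 ∧ widthAt C₃ e ≤ 2 ∧
      widthAt C₁ e + widthAt C₂ e + widthAt C₃ e ≤ 4) ∧
    (∀ e ∈ N, IsLoop ends e → sgn e = true → widthAt C₁ e = 2)

theorem isLoop_iff {ends : E → Sym2 V} {e : E} : IsLoop ends e ↔ ∃ v, ends e = s(v, v) := by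
  obtain ⟨a, b, h⟩ := exists_ends ends e
  unfold IsLoop
  rw [h]
  simp only [Sym2.mk_isDiag_iff, Sym2.eq_iff]
  constructor
  · rintro rfl; exact ⟨a, by simp⟩
  · rintro ⟨v, h⟩; rcases h with ⟨rfl, rfl⟩ | ⟨rfl, rfl⟩ <;> rfl

theorem SP.no_loop {ends : E → Sym2 V} {P S u v} (h : SP ends P S u v) :
    ∀ e ∈ P, ∀ x, ends e ≠ s(x, x) := by
  induction h with
  | nil => simp
  | @cons P S a b v e he ha h ih =>
    intro f hf x hx
    rcases Finset.mem_insert.1 hf with rfl | hf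
    · rw [he] at hx
      have h1 : a = x ∧ b = x := by
        rcases Sym2.eq_iff.1 hx with h | h <;> exact h
      exact ha (by rw [h1.1, ← h1.2]; exact h.left_mem)
    · exact ih f hf x hx

theorem supp_loop {ends : E → Sym2 V} {e : E} {v : V} (h : ends e = s(v, v)) :
    support ends {e} = {v} := by
  ext w
  simp [mem_supp, h]

theorem neg_loop {ends : E → Sym2 V} {sgn : E → Bool} {e : E} {v : V} (h : ends e = s(v, v))
    (hs : sgn e = true) : IsUnbalancedCircuit ends sgn {e} := by
  refine ⟨loop_circuit h, ?_⟩
  simp [negEdges, Finset.filter_singleton, hs]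

theorem loop_barbell {ends : E → Sym2 V} {sgn : E → Bool} {R : Finset E} {S : Finset V} {x y : V}
    {e f : E} (hR : SP ends R S x y) (hxy : x ≠ y) (he : ends e = s(x, x)) (hf : ends f = s(y, y))
    (hes : sgn e = true) (hfs : sgn f = true) : IsSignedCircuit ends sgn ({e} ∪ {f} ∪ R) := by
  right; right
  refine ⟨{e}, {f}, R, x, y, ?_, ?_, ?_, rfl, neg_loop he hes, neg_loop hf hfs, ?_,
    hR.isPath hxy, ?_, ?_⟩
  · rw [Finset.disjoint_singleton]
    rintro rfl
    rw [he] at hf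
    simp at hf
    exact hxy hf
  · rw [Finset.disjoint_singleton_left]
    exact fun h => hR.no_loop e h x he
  · rw [Finset.disjoint_singleton_left]
    exact fun h => hR.no_loop f h y hf
  · rw [supp_loop he, supp_loop hf]; simpa using hxy
  · rw [supp_loop he, hR.supp_eq hxy]; simpa using hR.left_mem
  · rw [supp_loop hf, hR.supp_eq hxy]; simpa using hR.right_mem

theorem circuit_loop_barbell {ends : E → Sym2 V} {sgn : E → Bool} {A : Finset E} {x : V}
    {e : E} (hA : IsUnbalancedCircuit ends sgn A) (hx : x ∈ support ends A)
    (he : ends e = s(x, x)) (hes : sgn e = true) (heA : e ∉ A) :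
    IsSignedCircuit ends sgn (A ∪ {e}) := by
  right; left
  refine ⟨A, {e}, by simpa using heA, rfl, hA, neg_loop he hes, x, ?_⟩
  rw [supp_loop he]; simpa using hx

/-- a barbell made of two marked loops and a path -/
def Bar (ends : E → Sym2 V) (l : V → E) (M : Finset V) (P D : Finset E) : Prop :=
  ∃ x ∈ M, ∃ y ∈ M, x ≠ y ∧ ∃ R S, R ⊆ P ∧ SP ends R S x y ∧ D = {l x} ∪ {l y} ∪ R

theorem Bar.mono {ends : E → Sym2 V} {l : V → E} {M M' : Finset V} {P P' D : Finset E}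
    (h : Bar ends l M P D) (hM : M ⊆ M') (hP : P ⊆ P') : Bar ends l M' P' D := by
  obtain ⟨x, hx, y, hy, hxy, R, S, hR, hs, hD⟩ := h
  exact ⟨x, hM hx, y, hM hy, hxy, R, S, hR.trans hP, hs, hD⟩

theorem Bar.width_zero {ends : E → Sym2 V} {l : V → E} {M : Finset V} {P : Finset E}
    {L : List (Finset E)} (h : ∀ D ∈ L, Bar ends l M P D) {e : E} (he : e ∉ P)
    (hM : ∀ x ∈ M, l x ≠ e) : widthAt L e = 0 := by
  apply widthAt_zero
  intro D hD hcon
  obtain ⟨x, hx, y, hy, hxy, R, S, hR, hs, rfl⟩ := h D hD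
  simp only [Finset.mem_union, Finset.mem_singleton] at hcon
  rcases hcon with (h | h) | h
  · exact hM x hx h.symm
  · exact hM y hy h.symm
  · exact he (hR h)

/-- result of the chain construction -/
def Chain (ends : E → Sym2 V) (l : V → E) (M : Finset V) (P : Finset E) (u v : V)
    (O Ev : List (Finset E)) : Prop :=
  (∀ D ∈ O, Bar ends l M P D) ∧ (∀ D ∈ Ev, Bar ends l M P D) ∧
  (∀ e ∈ P, widthAt O e + widthAt Ev e = 1) ∧
  (widthAt O (l u) = 1 ∧ widthAt Ev (l u) = 0) ∧
  (∀ x ∈ M, x ≠ u → x ≠ v → widthAt O (l x) = 1 ∧ widthAt Ev (l x) = 1) ∧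
  (Even M.card → widthAt O (l v) = 1 ∧ widthAt Ev (l v) = 0) ∧
  (¬ Even M.card → widthAt O (l v) = 0 ∧ widthAt Ev (l v) = 1)

theorem chain {ends : E → Sym2 V} {l : V → E} : ∀ (n : ℕ) (M : Finset V) (P : Finset E)
    (S : Finset V) (u v : V), M.card ≤ n → SP ends P S u v → u ≠ v → M ⊆ S → u ∈ M → v ∈ M →
    (∀ x ∈ M, ends (l x) = s(x, x)) → ∃ O Ev, Chain ends l M P u v O Ev := by
  intro n
  induction n with
  | zero =>
    intro M P S u v hn _ _ _ hu
    have := Finset.card_pos.2 ⟨u, hu⟩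
    omega
  | succ n ih =>
    intro M P S u v hn hP huv hMS hu hv hl
    have hinj : ∀ x ∈ M, ∀ y ∈ M, l x = l y → x = y := by
      intro x hx y hy h
      have h1 := hl x hx
      rw [h, hl y hy] at h1
      simp at h1
      exact h1.symm
    have hlP : ∀ x ∈ M, l x ∉ P := fun x hx h => hP.no_loop _ h x (hl x hx)
    by_cases hint : ∃ x ∈ M, x ≠ u ∧ x ≠ v
    · obtain ⟨x, hx, hxu, hxv⟩ := hint
      obtain ⟨P₁, S₁, P₂, S₂, h1, h2, hd, rfl, rfl, hi⟩ := hP.split x (hMS hx)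
      have hS : ∀ a, a ∈ S₁ → a ∈ S₂ → a = x := by
        intro a ha hb
        have : a ∈ S₁ ∩ S₂ := Finset.mem_inter.2 ⟨ha, hb⟩
        rw [hi] at this
        simpa using this
      have hu1 := h1.left_mem
      have hx1 := h1.right_mem
      have hx2 := h2.left_mem
      have hv2 := h2.right_mem
      have hu2 : u ∉ S₂ := fun h => hxu (hS u hu1 h).symm
      have hv1 : v ∉ S₁ := fun h => hxv (hS v h hv2).symm
      have hM1 : (M ∩ S₁).card < M.card := Finset.card_lt_card (by
        rw [Finset.ssubset_iff_of_subset Finset.inter_subset_left]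
        exact ⟨v, hv, by simp [hv1]⟩)
      have hM2 : (M ∩ S₂).card < M.card := Finset.card_lt_card (by
        rw [Finset.ssubset_iff_of_subset Finset.inter_subset_left]
        exact ⟨u, hu, by simp [hu2]⟩)
      have hMc : (M ∩ S₁).card + (M ∩ S₂).card = M.card + 1 := by
        have e1 : (M ∩ S₁) ∪ (M ∩ S₂) = M := by
          rw [← Finset.inter_union_distrib_left]; exact Finset.inter_eq_left.2 hMS
        have e2 : (M ∩ S₁) ∩ (M ∩ S₂) = {x} := by
          ext a
          simp only [Finset.mem_inter, Finset.mem_singleton]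
          constructor
          · rintro ⟨⟨_, ha⟩, _, hb⟩; exact hS a ha hb
          · rintro rfl; exact ⟨⟨hx, hx1⟩, hx, hx2⟩
        have := Finset.card_union_add_card_inter (M ∩ S₁) (M ∩ S₂)
        rw [e1, e2, Finset.card_singleton] at this
        exact this.symm
      obtain ⟨O₁, V₁, a1, a2, a3, a4, a5, a6, a7⟩ := ih (M ∩ S₁) P₁ S₁ u x (by omega) h1
        (Ne.symm hxu) Finset.inter_subset_right (by simp [hu, hu1]) (by simp [hx, hx1])
        (fun y hy => hl y (Finset.mem_inter.1 hy).1)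
      obtain ⟨O₂, V₂, b1, b2, b3, b4, b5, b6, b7⟩ := ih (M ∩ S₂) P₂ S₂ x v (by omega) h2
        hxv Finset.inter_subset_right (by simp [hx, hx2]) (by simp [hv, hv2])
        (fun y hy => hl y (Finset.mem_inter.1 hy).1)
      have z1 : ∀ e, e ∉ P₁ → (∀ y ∈ M ∩ S₁, l y ≠ e) → widthAt O₁ e = 0 ∧ widthAt V₁ e = 0 :=
        fun e h h' => ⟨Bar.width_zero a1 h h', Bar.width_zero a2 h h'⟩
      have z2 : ∀ e, e ∉ P₂ → (∀ y ∈ M ∩ S₂, l y ≠ e) → widthAt O₂ e = 0 ∧ widthAt V₂ e = 0 :=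
        fun e h h' => ⟨Bar.width_zero b1 h h', Bar.width_zero b2 h h'⟩
      have m1 : ∀ D, Bar ends l (M ∩ S₁) P₁ D → Bar ends l M (P₁ ∪ P₂) D := fun D h =>
        h.mono Finset.inter_subset_left Finset.subset_union_left
      have m2 : ∀ D, Bar ends l (M ∩ S₂) P₂ D → Bar ends l M (P₁ ∪ P₂) D := fun D h =>
        h.mono Finset.inter_subset_left Finset.subset_union_right
      have hn1 : ∀ e ∈ P₁ ∪ P₂, ∀ y ∈ M, l y ≠ e := fun e he y hy h => hlP y hy (h ▸ he)
      have zz1 : ∀ e ∈ P₂, widthAt O₁ e = 0 ∧ widthAt V₁ e = 0 := fun e he =>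
        z1 e (fun h => Finset.disjoint_left.1 hd h he) (fun y hy =>
          hn1 e (by simp [he]) y (Finset.mem_inter.1 hy).1)
      have zz2 : ∀ e ∈ P₁, widthAt O₂ e = 0 ∧ widthAt V₂ e = 0 := fun e he =>
        z2 e (fun h => Finset.disjoint_left.1 hd he h) (fun y hy =>
          hn1 e (by simp [he]) y (Finset.mem_inter.1 hy).1)
      have y1 : ∀ y ∈ M, y ∉ S₁ → widthAt O₁ (l y) = 0 ∧ widthAt V₁ (l y) = 0 := fun y hy hs =>
        z1 _ (fun h => hlP y hy (by simp [h])) (fun a ha h => hs (by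
          rw [Finset.mem_inter] at ha
          rw [← hinj a ha.1 y hy h]; exact ha.2))
      have y2 : ∀ y ∈ M, y ∉ S₂ → widthAt O₂ (l y) = 0 ∧ widthAt V₂ (l y) = 0 := fun y hy hs =>
        z2 _ (fun h => hlP y hy (by simp [h])) (fun a ha h => hs (by
          rw [Finset.mem_inter] at ha
          rw [← hinj a ha.1 y hy h]; exact ha.2))
      have yu := y2 u hu hu2
      have yv := y1 v hv hv1
      have hmid : ∀ y ∈ M, y ≠ u → y ≠ v → y ≠ x →
          widthAt O₁ (l y) + widthAt O₂ (l y) = 1 ∧ widthAt V₁ (l y) + widthAt V₂ (l y) = 1 ∧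
          widthAt O₁ (l y) + widthAt V₂ (l y) = 1 ∧ widthAt V₁ (l y) + widthAt O₂ (l y) = 1 := by
        intro y hy hyu hyv hyx
        rcases Finset.mem_union.1 (hMS hy) with h | h
        · have h' := a5 y (by simp [hy, h]) hyu hyx
          have h'' := y2 y hy (fun hh => hyx (hS y h hh))
          omega
        · have h' := b5 y (by simp [hy, h]) hyx hyv
          have h'' := y1 y hy (fun hh => hyx (hS y hh h))
          omega
      by_cases hpar : Even (M ∩ S₁).card
      · have a6' := a6 hpar
        refine ⟨O₁ ++ V₂, V₁ ++ O₂, ?_, ?_, ?_, ?_, ?_, ?_, ?_⟩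
        · intro D hD
          rcases List.mem_append.1 hD with h | h
          · exact m1 D (a1 D h)
          · exact m2 D (b2 D h)
        · intro D hD
          rcases List.mem_append.1 hD with h | h
          · exact m1 D (a2 D h)
          · exact m2 D (b1 D h)
        · intro e he
          simp only [widthAt_append]
          rcases Finset.mem_union.1 he with h | h
          · have := a3 e h; have := zz2 e h; omega
          · have := b3 e h; have := zz1 e h; omega
        · simp only [widthAt_append]; omega
        · intro y hy hyu hyv
          simp only [widthAt_append]
          by_cases hyx : y = x
          · subst hyx; omega
          · have := hmid y hy hyu hyv hyx; omega
        · intro hev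
          have : ¬ Even (M ∩ S₂).card := by
            rw [Nat.even_iff] at *; omega
          have := b7 this
          simp only [widthAt_append]; omega
        · intro hev
          have : Even (M ∩ S₂).card := by
            rw [Nat.even_iff] at *; omega
          have := b6 this
          simp only [widthAt_append]; omega
      · have a7' := a7 hpar
        refine ⟨O₁ ++ O₂, V₁ ++ V₂, ?_, ?_, ?_, ?_, ?_, ?_, ?_⟩
        · intro D hD
          rcases List.mem_append.1 hD with h | h
          · exact m1 D (a1 D h)
          · exact m2 D (b1 D h)
        · intro D hD
          rcases List.mem_append.1 hD with h | h
          · exact m1 D (a2 D h)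
          · exact m2 D (b2 D h)
        · intro e he
          simp only [widthAt_append]
          rcases Finset.mem_union.1 he with h | h
          · have := a3 e h; have := zz2 e h; omega
          · have := b3 e h; have := zz1 e h; omega
        · simp only [widthAt_append]; omega
        · intro y hy hyu hyv
          simp only [widthAt_append]
          by_cases hyx : y = x
          · subst hyx; omega
          · have := hmid y hy hyu hyv hyx; omega
        · intro hev
          have : Even (M ∩ S₂).card := by
            rw [Nat.even_iff] at *; omega
          have := b6 this
          simp only [widthAt_append]; omega
        · intro hev
          have : ¬ Even (M ∩ S₂).card := by
            rw [Nat.even_iff] at *; omega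
          have := b7 this
          simp only [widthAt_append]; omega
    · push Not at hint
      have hM : M = {u, v} := by
        ext x
        simp only [Finset.mem_insert, Finset.mem_singleton]
        constructor
        · intro hx
          by_cases h : x = u
          · exact Or.inl h
          · exact Or.inr (hint x hx h)
        · rintro (rfl | rfl)
          · exact hu
          · exact hv
      have hcard : M.card = 2 := by rw [hM, Finset.card_pair huv]
      refine ⟨[{l u} ∪ {l v} ∪ P], [], ?_, by simp, ?_, ?_, ?_, ?_, ?_⟩
      · intro D hD
        rw [List.mem_singleton] at hD
        exact ⟨u, hu, v, hv, huv, P, S, Finset.Subset.refl _, hP, hD⟩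
      · intro e he
        simp [widthAt_cons, widthAt_nil, he]
      · simp [widthAt_cons, widthAt_nil]
      · intro x hx h1 h2
        exact absurd (hint x hx h1) h2
      · intro _
        simp [widthAt_cons, widthAt_nil]
      · intro h
        rw [hcard] at h
        exact absurd (by decide) h


/-! ### A circuit with negative loops -/

theorem Cov.of {ends : E → Sym2 V} {sgn : E → Bool} {F : Finset E} {C₁ C₂ C₃ : List (Finset E)}
    (h1 : ∀ C ∈ C₁, IsSignedCircuit ends sgn C ∧ C ⊆ F)
    (h2 : ∀ C ∈ C₂, IsSignedCircuit ends sgn C ∧ C ⊆ F)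
    (h3 : ∀ C ∈ C₃, IsSignedCircuit ends sgn C ∧ C ⊆ F)
    (hw : ∀ e ∈ F, (1 ≤ widthAt C₁ e ∧ 1 ≤ widthAt C₂ e ∧ 1 ≤ widthAt C₃ e) ∧
      (widthAt C₁ e ≤ 2 ∧ widthAt C₂ e ≤ 2 ∧ widthAt C₃ e ≤ 2 ∧
      widthAt C₁ e + widthAt C₂ e + widthAt C₃ e ≤ 4) ∧
      (IsLoop ends e → sgn e = true → widthAt C₁ e = 2)) : Cov ends sgn F F := by
  refine ⟨C₁, C₂, C₃, h1, h2, h3, fun e he => (hw e he).1, ?_, fun e he => (hw e he).2.2⟩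
  intro e
  by_cases he : e ∈ F
  · exact (hw e he).2.1
  · rw [widthAt_zero (fun C hC h => he ((h1 C hC).2 h)),
      widthAt_zero (fun C hC h => he ((h2 C hC).2 h)),
      widthAt_zero (fun C hC h => he ((h3 C hC).2 h))]
    simp

theorem Bar.signed {ends : E → Sym2 V} {sgn : E → Bool} {l : V → E} {M : Finset V}
    {P D : Finset E} (h : Bar ends l M P D)
    (hl : ∀ x ∈ M, ends (l x) = s(x, x) ∧ sgn (l x) = true) :
    IsSignedCircuit ends sgn D ∧ D ⊆ P ∪ M.image l := by
  obtain ⟨x, hx, y, hy, hxy, R, S, hR, hs, rfl⟩ := h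
  refine ⟨loop_barbell hs hxy (hl x hx).1 (hl y hy).1 (hl x hx).2 (hl y hy).2, ?_⟩
  intro e he
  simp only [Finset.mem_union, Finset.mem_singleton, Finset.mem_image] at *
  rcases he with (rfl | rfl) | h
  · exact Or.inr ⟨x, hx, rfl⟩
  · exact Or.inr ⟨y, hy, rfl⟩
  · exact Or.inl (hR h)

theorem twoChains {ends : E → Sym2 V} {l : V → E} {M : Finset V} {P Q : Finset E}
    {S T : Finset V} {u v : V} (hP : SP ends P S u v) (hQ : SP ends Q T u v) (huv : u ≠ v)
    (hd : Disjoint P Q) (hST : S ∩ T = {u, v}) (hM : M ⊆ S ∪ T) (hu : u ∈ M) (hv : v ∈ M)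
    (hl : ∀ x ∈ M, ends (l x) = s(x, x)) :
    ∃ OP EP OQ EQ : List (Finset E),
      (∀ D ∈ OP, Bar ends l M (P ∪ Q) D) ∧ (∀ D ∈ EP, Bar ends l M (P ∪ Q) D) ∧
      (∀ D ∈ OQ, Bar ends l M (P ∪ Q) D) ∧ (∀ D ∈ EQ, Bar ends l M (P ∪ Q) D) ∧
      (∀ e ∈ P, widthAt OP e + widthAt EP e = 1 ∧ widthAt OQ e = 0 ∧ widthAt EQ e = 0) ∧
      (∀ e ∈ Q, widthAt OQ e + widthAt EQ e = 1 ∧ widthAt OP e = 0 ∧ widthAt EP e = 0) ∧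
      (widthAt OP (l u) = 1 ∧ widthAt EP (l u) = 0 ∧ widthAt OQ (l u) = 1 ∧
        widthAt EQ (l u) = 0) ∧
      (∀ x ∈ M, x ≠ u → x ≠ v →
        (widthAt OP (l x) = 1 ∧ widthAt EP (l x) = 1 ∧ widthAt OQ (l x) = 0 ∧
          widthAt EQ (l x) = 0) ∨
        (widthAt OP (l x) = 0 ∧ widthAt EP (l x) = 0 ∧ widthAt OQ (l x) = 1 ∧
          widthAt EQ (l x) = 1)) ∧
      (Even (M ∩ S).card → widthAt OP (l v) = 1 ∧ widthAt EP (l v) = 0) ∧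
      (¬ Even (M ∩ S).card → widthAt OP (l v) = 0 ∧ widthAt EP (l v) = 1) ∧
      (Even (M ∩ T).card → widthAt OQ (l v) = 1 ∧ widthAt EQ (l v) = 0) ∧
      (¬ Even (M ∩ T).card → widthAt OQ (l v) = 0 ∧ widthAt EQ (l v) = 1) := by
  obtain ⟨O₁, V₁, a1, a2, a3, a4, a5, a6, a7⟩ := chain _ (M ∩ S) P S u v le_rfl hP huv
    Finset.inter_subset_right (by simp [hu, hP.left_mem]) (by simp [hv, hP.right_mem])
    (fun y hy => hl y (Finset.mem_inter.1 hy).1)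
  obtain ⟨O₂, V₂, b1, b2, b3, b4, b5, b6, b7⟩ := chain _ (M ∩ T) Q T u v le_rfl hQ huv
    Finset.inter_subset_right (by simp [hu, hQ.left_mem]) (by simp [hv, hQ.right_mem])
    (fun y hy => hl y (Finset.mem_inter.1 hy).1)
  have hinj : ∀ x ∈ M, ∀ y ∈ M, l x = l y → x = y := by
    intro x hx y hy h
    have h1 := hl x hx
    rw [h, hl y hy] at h1
    simp at h1
    exact h1.symm
  have hlP : ∀ x ∈ M, l x ∉ P := fun x hx h => hP.no_loop _ h x (hl x hx)
  have hlQ : ∀ x ∈ M, l x ∉ Q := fun x hx h => hQ.no_loop _ h x (hl x hx)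
  refine ⟨O₁, V₁, O₂, V₂,
    fun D h => (a1 D h).mono Finset.inter_subset_left Finset.subset_union_left,
    fun D h => (a2 D h).mono Finset.inter_subset_left Finset.subset_union_left,
    fun D h => (b1 D h).mono Finset.inter_subset_left Finset.subset_union_right,
    fun D h => (b2 D h).mono Finset.inter_subset_left Finset.subset_union_right,
    ?_, ?_, ⟨a4.1, a4.2, b4.1, b4.2⟩, ?_, a6, a7, b6, b7⟩
  · intro e he
    have hq : e ∉ Q := Finset.disjoint_left.1 hd he
    have hx : ∀ x ∈ M ∩ T, l x ≠ e := fun x hx h => hlP x (Finset.mem_inter.1 hx).1 (h ▸ he)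
    exact ⟨a3 e he, Bar.width_zero b1 hq hx, Bar.width_zero b2 hq hx⟩
  · intro e he
    have hq : e ∉ P := Finset.disjoint_right.1 hd he
    have hx : ∀ x ∈ M ∩ S, l x ≠ e := fun x hx h => hlQ x (Finset.mem_inter.1 hx).1 (h ▸ he)
    exact ⟨b3 e he, Bar.width_zero a1 hq hx, Bar.width_zero a2 hq hx⟩
  · intro x hx hxu hxv
    have hnot : ¬ (x ∈ S ∧ x ∈ T) := by
      intro h
      have : x ∈ S ∩ T := Finset.mem_inter.2 h
      rw [hST] at this
      simp [hxu, hxv] at this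
    rcases Finset.mem_union.1 (hM hx) with h | h
    · left
      have hx' : ∀ y ∈ M ∩ T, l y ≠ l x := fun y hy hh => by
        rw [Finset.mem_inter] at hy
        exact hnot ⟨h, hinj y hy.1 x hx hh ▸ hy.2⟩
      have := a5 x (by simp [hx, h]) hxu hxv
      exact ⟨this.1, this.2, Bar.width_zero b1 (hlQ x hx) hx', Bar.width_zero b2 (hlQ x hx) hx'⟩
    · right
      have hx' : ∀ y ∈ M ∩ S, l y ≠ l x := fun y hy hh => by
        rw [Finset.mem_inter] at hy
        exact hnot ⟨hinj y hy.1 x hx hh ▸ hy.2, h⟩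
      have := b5 x (by simp [hx, h]) hxu hxv
      exact ⟨Bar.width_zero a1 (hlP x hx) hx', Bar.width_zero a2 (hlP x hx) hx', this.1, this.2⟩

theorem direct_odd {ends : E → Sym2 V} {sgn : E → Bool} {l : V → E} {M : Finset V} {P Q : Finset E}
    {S T : Finset V} {u v : V} (hP : SP ends P S u v) (hQ : SP ends Q T u v) (huv : u ≠ v)
    (hd : Disjoint P Q) (hST : S ∩ T = {u, v}) (hM : M ⊆ S ∪ T) (hu : u ∈ M) (hv : v ∈ M)
    (hl : ∀ x ∈ M, ends (l x) = s(x, x) ∧ sgn (l x) = true)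
    (hA : IsUnbalancedCircuit ends sgn (P ∪ Q))
    (hS : Even (M ∩ S).card) (hT : ¬ Even (M ∩ T).card) :
    Cov ends sgn (P ∪ Q ∪ M.image l) (P ∪ Q ∪ M.image l) := by
  obtain ⟨OP, EP, OQ, EQ, a1, a2, a3, a4, hp, hq, wu, wx, v1, -, -, v2⟩ :=
    twoChains hP hQ huv hd hST hM hu hv (fun x hx => (hl x hx).1)
  replace v1 := v1 hS
  replace v2 := v2 hT
  have hinj : ∀ x ∈ M, ∀ y ∈ M, l x = l y → x = y := by
    intro x hx y hy h
    have h1 := (hl x hx).1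
    rw [h, (hl y hy).1] at h1
    simp at h1
    exact h1.symm
  have hlP : ∀ x ∈ M, l x ∉ P := fun x hx h => hP.no_loop _ h x (hl x hx).1
  have hlQ : ∀ x ∈ M, l x ∉ Q := fun x hx h => hQ.no_loop _ h x (hl x hx).1
  have hlA : ∀ x ∈ M, l x ∉ P ∪ Q := fun x hx h => by
    rcases Finset.mem_union.1 h with h | h
    · exact hlP x hx h
    · exact hlQ x hx h
  have hsupp : ∀ x ∈ M, x ∈ support ends (P ∪ Q) := by
    intro x hx
    rw [supp_union, hP.supp_eq huv, hQ.supp_eq huv]; exact hM hx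
  have hbb : ∀ x ∈ M, IsSignedCircuit ends sgn (P ∪ Q ∪ {l x}) ∧
      P ∪ Q ∪ {l x} ⊆ P ∪ Q ∪ M.image l := by
    intro x hx
    refine ⟨circuit_loop_barbell hA (hsupp x hx) (hl x hx).1 (hl x hx).2 (hlA x hx), ?_⟩
    refine Finset.union_subset_union (Finset.Subset.refl _) ?_
    rw [Finset.singleton_subset_iff]
    exact Finset.mem_image_of_mem _ hx
  obtain ⟨D, hD, hvD⟩ := widthAt_pos (L := EQ) (e := l v) (by omega)
  obtain ⟨z, hz, hzv, hDz⟩ : ∃ z ∈ M, z ≠ v ∧ ∀ x ∈ M, l x ∈ D ↔ (x = v ∨ x = z) := by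
    obtain ⟨x, hx, y, hy, hxy, R, S', hR, hs, rfl⟩ := a4 D hD
    have key : ∀ a ∈ M, l a ∈ ({l x} ∪ {l y} ∪ R : Finset E) ↔ (a = x ∨ a = y) := by
      intro a ha
      simp only [Finset.mem_union, Finset.mem_singleton]
      constructor
      · rintro ((h | h) | h)
        · exact Or.inl (hinj a ha x hx h)
        · exact Or.inr (hinj a ha y hy h)
        · exact absurd (hR h) (hlA a ha)
      · rintro (rfl | rfl) <;> simp
    rcases (key v hv).1 hvD with rfl | rfl
    · exact ⟨y, hy, Ne.symm hxy, key⟩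
    · exact ⟨x, hx, hxy, fun a ha => (key a ha).trans or_comm⟩
  obtain ⟨L₁, L₂, hL⟩ := List.append_of_mem hD
  have hEQ : ∀ e, widthAt EQ e = (if e ∈ D then 1 else 0) + widthAt (L₁ ++ L₂) e := by
    intro e
    rw [hL]
    simp only [widthAt_append, widthAt_cons]
    omega
  have hL' : ∀ C ∈ L₁ ++ L₂, C ∈ EQ := by
    intro C hC
    rw [hL]
    simp only [List.mem_append, List.mem_cons] at *
    tauto
  refine Cov.of (C₁ := OP ++ EP ++ OQ ++ EQ)
    (C₂ := (P ∪ Q ∪ {l z}) :: (OP ++ (L₁ ++ L₂))) (C₃ := (P ∪ Q ∪ {l v}) :: (EP ++ OQ)) ?_ ?_ ?_ ?_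
  · intro C hC
    simp only [List.mem_append] at hC
    rcases hC with ((h | h) | h) | h
    · exact (a1 C h).signed hl
    · exact (a2 C h).signed hl
    · exact (a3 C h).signed hl
    · exact (a4 C h).signed hl
  · intro C hC
    rcases List.mem_cons.1 hC with rfl | hC
    · exact hbb z hz
    · rcases List.mem_append.1 hC with h | h
      · exact (a1 C h).signed hl
      · exact (a4 C (hL' C h)).signed hl
  · intro C hC
    rcases List.mem_cons.1 hC with rfl | hC
    · exact hbb v hv
    · rcases List.mem_append.1 hC with h | h
      · exact (a2 C h).signed hl
      · exact (a3 C h).signed hl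
  · intro e he
    have hE := hEQ e
    rw [widthAt_cons, widthAt_cons, widthAt_append OP, widthAt_append EP OQ,
      widthAt_append _ EQ, widthAt_append _ OQ, widthAt_append OP EP]
    rcases Finset.mem_union.1 he with heA | heM
    · have hnl : ¬ IsLoop ends e := by
        rw [isLoop_iff]
        rintro ⟨x, hx⟩
        rcases Finset.mem_union.1 heA with h | h
        · exact hP.no_loop e h x hx
        · exact hQ.no_loop e h x hx
      rw [if_pos (Finset.mem_union_left _ heA), if_pos (Finset.mem_union_left _ heA)]
      have : (widthAt OP e + widthAt EP e = 1 ∧ widthAt OQ e = 0 ∧ widthAt EQ e = 0) ∨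
          (widthAt OQ e + widthAt EQ e = 1 ∧ widthAt OP e = 0 ∧ widthAt EP e = 0) := by
        rcases Finset.mem_union.1 heA with h | h
        · exact Or.inl (hp e h)
        · exact Or.inr (hq e h)
      refine ⟨?_, ?_, fun h => absurd h hnl⟩ <;> omega
    · obtain ⟨x, hx, rfl⟩ := Finset.mem_image.1 heM
      have i1 : ∀ y ∈ M, (l x ∈ P ∪ Q ∪ {l y} ↔ x = y) := by
        intro y hy
        rw [Finset.mem_union, Finset.mem_singleton]
        constructor
        · rintro (h | h)
          · exact absurd h (hlA x hx)
          · exact hinj x hx y hy h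
        · rintro rfl; exact Or.inr rfl
      simp only [i1 z hz, i1 v hv]
      simp only [hDz x hx] at hE
      by_cases hxv : x = v
      · subst hxv
        simp only [true_or, if_true, hzv.symm, if_false] at hE ⊢
        omega
      · by_cases hxu : x = u
        · subst hxu
          simp only [hxv, false_or, if_false] at hE ⊢
          omega
        · have := wx x hx hxu hxv
          simp only [hxv, false_or, if_false] at hE ⊢
          omega

theorem direct {ends : E → Sym2 V} {sgn : E → Bool} {l : V → E} {M : Finset V} {A : Finset E}
    (hA : IsCircuit ends A) (hAl : ∀ e ∈ A, ¬ IsLoop ends e) (hM : M ⊆ support ends A)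
    (hl : ∀ x ∈ M, ends (l x) = s(x, x) ∧ sgn (l x) = true)
    (hpar : Even ((negEdges sgn A).card + M.card)) :
    Cov ends sgn (A ∪ M.image l) (A ∪ M.image l) := by
  have hlA : ∀ x ∈ M, l x ∉ A := fun x hx h => hAl _ h (isLoop_iff.2 ⟨x, (hl x hx).1⟩)
  rcases Nat.lt_or_ge M.card 2 with hlt | hge
  · rcases Finset.eq_empty_or_nonempty M with rfl | ⟨x, hx⟩
    · have hs : IsSignedCircuit ends sgn A := Or.inl ⟨hA, by simpa using hpar⟩
      refine Cov.of (C₁ := [A]) (C₂ := [A]) (C₃ := [A]) ?_ ?_ ?_ ?_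
      · intro C hC; rw [List.mem_singleton] at hC; subst hC; exact ⟨hs, by simp⟩
      · intro C hC; rw [List.mem_singleton] at hC; subst hC; exact ⟨hs, by simp⟩
      · intro C hC; rw [List.mem_singleton] at hC; subst hC; exact ⟨hs, by simp⟩
      · intro e he
        have he : e ∈ A := by simpa using he
        simp only [widthAt_cons, widthAt_nil, he, if_true]
        exact ⟨by omega, by omega, fun h => absurd h (hAl e he)⟩
    · have hMx : M = {x} := by
        have h1 : M.card = 1 := by have := Finset.card_pos.2 ⟨x, hx⟩; omega
        obtain ⟨y, hy⟩ := Finset.card_eq_one.1 h1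
        rw [hy] at hx ⊢
        rw [Finset.mem_singleton.1 hx]
      subst hMx
      have hs : IsSignedCircuit ends sgn (A ∪ {l x}) := by
        refine circuit_loop_barbell ⟨hA, ?_⟩ (hM hx) (hl x hx).1 (hl x hx).2 (hlA x hx)
        rw [Finset.card_singleton] at hpar
        rw [Nat.odd_iff]; rw [Nat.even_iff] at hpar; omega
      rw [Finset.image_singleton]
      refine Cov.of (C₁ := [A ∪ {l x}, A ∪ {l x}]) (C₂ := [A ∪ {l x}]) (C₃ := [A ∪ {l x}]) ?_ ?_ ?_ ?_
      · intro C hC; simp only [List.mem_cons, List.not_mem_nil, or_false, or_self] at hC; subst hC; exact ⟨hs, by simp⟩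
      · intro C hC; rw [List.mem_singleton] at hC; subst hC; exact ⟨hs, by simp⟩
      · intro C hC; rw [List.mem_singleton] at hC; subst hC; exact ⟨hs, by simp⟩
      · intro e he
        simp only [widthAt_cons, widthAt_nil, he, if_true]
        exact ⟨by omega, by omega, by intros; trivial⟩
  · obtain ⟨u, hu, v, hv, huv⟩ := Finset.one_lt_card.1 (show 1 < M.card by omega)
    obtain ⟨P, S, Q, T, hP, hQ, hd, rfl, hST⟩ := circuit_arcs hA (hM hu) (hM hv) huv
    have hM' : M ⊆ S ∪ T := by
      rw [supp_union, hP.supp_eq huv, hQ.supp_eq huv] at hM; exact hM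
    have hcard : (M ∩ S).card + (M ∩ T).card = M.card + 2 := by
      have e1 : (M ∩ S) ∪ (M ∩ T) = M := by
        rw [← Finset.inter_union_distrib_left]; exact Finset.inter_eq_left.2 hM'
      have e2 : (M ∩ S) ∩ (M ∩ T) = {u, v} := by
        rw [← Finset.inter_inter_distrib_left, hST]
        apply Finset.inter_eq_right.2
        intro a ha
        simp only [Finset.mem_insert, Finset.mem_singleton] at ha
        rcases ha with rfl | rfl <;> assumption
      have := Finset.card_union_add_card_inter (M ∩ S) (M ∩ T)
      rw [e1, e2, Finset.card_pair huv] at this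
      exact this.symm
    by_cases hMe : Even M.card
    · have hAe : Even (negEdges sgn (P ∪ Q)).card := (Nat.even_add.1 hpar).2 hMe
      have hs : IsSignedCircuit ends sgn (P ∪ Q) := Or.inl ⟨hA, hAe⟩
      obtain ⟨OP, EP, OQ, EQ, a1, a2, a3, a4, hp, hq, wu, wx, v1, v2, v3, v4⟩ :=
        twoChains hP hQ huv hd hST hM' hu hv (fun x hx => (hl x hx).1)
      have hvv : widthAt OP (l v) + widthAt EQ (l v) = 1 ∧ widthAt EP (l v) + widthAt OQ (l v) = 1 := by
        by_cases hS : Even (M ∩ S).card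
        · have hT : Even (M ∩ T).card := by rw [Nat.even_iff] at *; omega
          have := v1 hS; have := v3 hT; omega
        · have hT : ¬ Even (M ∩ T).card := by rw [Nat.even_iff] at *; omega
          have := v2 hS; have := v4 hT; omega
      refine Cov.of (C₁ := OP ++ EP ++ OQ ++ EQ)
        (C₂ := (P ∪ Q) :: (OP ++ EQ)) (C₃ := (P ∪ Q) :: (EP ++ OQ)) ?_ ?_ ?_ ?_
      · intro C hC
        simp only [List.mem_append] at hC
        rcases hC with ((h | h) | h) | h
        · exact (a1 C h).signed hl
        · exact (a2 C h).signed hl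
        · exact (a3 C h).signed hl
        · exact (a4 C h).signed hl
      · intro C hC
        rcases List.mem_cons.1 hC with rfl | hC
        · exact ⟨hs, Finset.subset_union_left⟩
        · rcases List.mem_append.1 hC with h | h
          · exact (a1 C h).signed hl
          · exact (a4 C h).signed hl
      · intro C hC
        rcases List.mem_cons.1 hC with rfl | hC
        · exact ⟨hs, Finset.subset_union_left⟩
        · rcases List.mem_append.1 hC with h | h
          · exact (a2 C h).signed hl
          · exact (a3 C h).signed hl
      · intro e he
        simp only [widthAt_cons, widthAt_append]
        rcases Finset.mem_union.1 he with heA | heM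
        · rw [if_pos heA]
          have : (widthAt OP e + widthAt EP e = 1 ∧ widthAt OQ e = 0 ∧ widthAt EQ e = 0) ∨
              (widthAt OQ e + widthAt EQ e = 1 ∧ widthAt OP e = 0 ∧ widthAt EP e = 0) := by
            rcases Finset.mem_union.1 heA with h | h
            · exact Or.inl (hp e h)
            · exact Or.inr (hq e h)
          refine ⟨?_, ?_, fun h => absurd h (hAl e heA)⟩ <;> omega
        · obtain ⟨x, hx, rfl⟩ := Finset.mem_image.1 heM
          rw [if_neg (hlA x hx)]
          by_cases hxv : x = v
          · subst hxv; omega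
          · by_cases hxu : x = u
            · subst hxu; omega
            · have := wx x hx hxu hxv
              omega
    · have hAo : IsUnbalancedCircuit ends sgn (P ∪ Q) := by
        refine ⟨hA, ?_⟩
        rw [← Nat.not_even_iff_odd]
        exact fun h => hMe ((Nat.even_add.1 hpar).1 h)
      by_cases hS : Even (M ∩ S).card
      · have hT : ¬ Even (M ∩ T).card := by rw [Nat.even_iff] at *; omega
        exact direct_odd hP hQ huv hd hST hM' hu hv hl hAo hS hT
      · have hT : Even (M ∩ T).card := by rw [Nat.even_iff] at *; omega
        rw [Finset.union_comm P Q] at hAo ⊢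
        exact direct_odd hQ hP huv hd.symm (by rw [Finset.inter_comm]; exact hST)
          (by rw [Finset.union_comm]; exact hM') hu hv hl hAo hT hS


/-! ### Combining and glueing covers -/

theorem Cov.mono {ends : E → Sym2 V} {sgn : E → Bool} {N F F' : Finset E}
    (h : Cov ends sgn N F) (hF : F ⊆ F') : Cov ends sgn N F' := by
  obtain ⟨C₁, C₂, C₃, h1, h2, h3, h4⟩ := h
  exact ⟨C₁, C₂, C₃, fun C hC => ⟨(h1 C hC).1, (h1 C hC).2.trans hF⟩,
    fun C hC => ⟨(h2 C hC).1, (h2 C hC).2.trans hF⟩,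
    fun C hC => ⟨(h3 C hC).1, (h3 C hC).2.trans hF⟩, h4⟩

theorem widthAt_sub {L : List (Finset E)} {F : Finset E} {e : E} (h : ∀ C ∈ L, C ⊆ F)
    (he : e ∉ F) : widthAt L e = 0 := widthAt_zero fun C hC hh => he (h C hC hh)

theorem Cov.combine {ends : E → Sym2 V} {sgn : E → Bool} {N₁ F₁ N₂ F₂ : Finset E}
    (h1 : Cov ends sgn N₁ F₁) (h2 : Cov ends sgn N₂ F₂) (hd : Disjoint F₁ F₂)
    (hN₁ : N₁ ⊆ F₁) (hN₂ : N₂ ⊆ F₂) : Cov ends sgn (N₁ ∪ N₂) (F₁ ∪ F₂) := by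
  obtain ⟨A₁, A₂, A₃, a1, a2, a3, a4, a5, a6⟩ := h1
  obtain ⟨B₁, B₂, B₃, b1, b2, b3, b4, b5, b6⟩ := h2
  have za : ∀ e, e ∉ F₁ → widthAt A₁ e = 0 ∧ widthAt A₂ e = 0 ∧ widthAt A₃ e = 0 := fun e he =>
    ⟨widthAt_sub (fun C h => (a1 C h).2) he, widthAt_sub (fun C h => (a2 C h).2) he,
      widthAt_sub (fun C h => (a3 C h).2) he⟩
  have zb : ∀ e, e ∉ F₂ → widthAt B₁ e = 0 ∧ widthAt B₂ e = 0 ∧ widthAt B₃ e = 0 := fun e he =>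
    ⟨widthAt_sub (fun C h => (b1 C h).2) he, widthAt_sub (fun C h => (b2 C h).2) he,
      widthAt_sub (fun C h => (b3 C h).2) he⟩
  have app : ∀ A B : List (Finset E), (∀ C ∈ A, IsSignedCircuit ends sgn C ∧ C ⊆ F₁) →
      (∀ C ∈ B, IsSignedCircuit ends sgn C ∧ C ⊆ F₂) →
      ∀ C ∈ A ++ B, IsSignedCircuit ends sgn C ∧ C ⊆ F₁ ∪ F₂ := by
    intro A B hA hB C hC
    rcases List.mem_append.1 hC with h | h
    · exact ⟨(hA C h).1, (hA C h).2.trans Finset.subset_union_left⟩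
    · exact ⟨(hB C h).1, (hB C h).2.trans Finset.subset_union_right⟩
  refine ⟨A₁ ++ B₁, A₂ ++ B₂, A₃ ++ B₃, app _ _ a1 b1, app _ _ a2 b2, app _ _ a3 b3, ?_, ?_, ?_⟩
  · intro e he
    simp only [widthAt_append]
    rcases Finset.mem_union.1 he with h | h
    · have := a4 e h; omega
    · have := b4 e h; omega
  · intro e
    simp only [widthAt_append]
    by_cases h : e ∈ F₁
    · have := zb e (Finset.disjoint_left.1 hd h); have := a5 e; omega
    · have := za e h; have := b5 e; omega
  · intro e he hl hs
    simp only [widthAt_append]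
    rcases Finset.mem_union.1 he with h | h
    · have := zb e (Finset.disjoint_left.1 hd (hN₁ h)); have := a6 e h hl hs; omega
    · have := za e (Finset.disjoint_right.1 hd (hN₂ h)); have := b6 e h hl hs; omega

section congr
variable {ends ends' : E → Sym2 V} {sgn sgn' : E → Bool}

theorem supp_congr {F : Finset E} (h : ∀ e ∈ F, ends e = ends' e) :
    support ends F = support ends' F := by
  ext v
  rw [mem_supp, mem_supp]
  constructor
  · rintro ⟨e, he, hv⟩; exact ⟨e, he, by rwa [← h e he]⟩
  · rintro ⟨e, he, hv⟩; exact ⟨e, he, by rwa [h e he]⟩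

theorem deg_congr {F : Finset E} (h : ∀ e ∈ F, ends e = ends' e) (v : V) :
    degree ends F v = degree ends' F v := by
  unfold degree
  exact Finset.sum_congr rfl fun e he => by rw [h e he]

theorem reach_congr {F : Finset E} (h : ∀ e ∈ F, ends e = ends' e) {u v : V}
    (hr : Reach ends F u v) : Reach ends' F u v := by
  induction hr with
  | refl => exact Relation.ReflTransGen.refl
  | tail _ h' ih =>
    obtain ⟨e, he, hab⟩ := h'
    exact ih.tail ⟨e, he, by rw [← h e he]; exact hab⟩

theorem conn_congr {F : Finset E} (h : ∀ e ∈ F, ends e = ends' e)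
    (hc : ConnectedOn ends F) : ConnectedOn ends' F := by
  intro u hu v hv
  rw [← supp_congr h] at hu hv
  exact reach_congr h (hc u hu v hv)

theorem circuit_congr {F : Finset E} (h : ∀ e ∈ F, ends e = ends' e)
    (hc : IsCircuit ends F) : IsCircuit ends' F := by
  refine ⟨hc.1, conn_congr h hc.2.1, fun v hv => ?_⟩
  rw [← supp_congr h] at hv
  rw [← deg_congr h]
  exact hc.2.2 v hv

theorem neg_congr {F : Finset E} (h : ∀ e ∈ F, sgn e = sgn' e) :
    negEdges sgn F = negEdges sgn' F := by
  unfold negEdges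
  exact Finset.filter_congr fun e he => by rw [h e he]

theorem unb_congr {F : Finset E} (h : ∀ e ∈ F, ends e = ends' e ∧ sgn e = sgn' e)
    (hc : IsUnbalancedCircuit ends sgn F) : IsUnbalancedCircuit ends' sgn' F :=
  ⟨circuit_congr (fun e he => (h e he).1) hc.1, by
    rw [← neg_congr (fun e he => (h e he).2)]; exact hc.2⟩

theorem path_congr {F : Finset E} (h : ∀ e ∈ F, ends e = ends' e) {u v : V}
    (hc : IsPath ends F u v) : IsPath ends' F u v := by
  obtain ⟨h1, h2, h3, h4, h5, h6, h7, h8⟩ := hc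
  rw [supp_congr h] at h4 h5 h8
  rw [deg_congr h] at h6 h7
  refine ⟨h1, conn_congr h h2, h3, h4, h5, h6, h7, fun w a b c => ?_⟩
  rw [← deg_congr h]
  exact h8 w a b c

theorem signed_congr {F : Finset E} (h : ∀ e ∈ F, ends e = ends' e ∧ sgn e = sgn' e)
    (hc : IsSignedCircuit ends sgn F) : IsSignedCircuit ends' sgn' F := by
  rcases hc with hc | ⟨C₁, C₂, hd, rfl, h1, h2, v, hv⟩ |
    ⟨C₁, C₂, P, u, v, d1, d2, d3, rfl, h1, h2, h3, h4, h5, h6⟩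
  · exact Or.inl ⟨circuit_congr (fun e he => (h e he).1) hc.1, by
      rw [← neg_congr (fun e he => (h e he).2)]; exact hc.2⟩
  · have k1 : ∀ e ∈ C₁, ends e = ends' e ∧ sgn e = sgn' e := fun e he => h e (by simp [he])
    have k2 : ∀ e ∈ C₂, ends e = ends' e ∧ sgn e = sgn' e := fun e he => h e (by simp [he])
    refine Or.inr (Or.inl ⟨C₁, C₂, hd, rfl, unb_congr k1 h1, unb_congr k2 h2, v, ?_⟩)
    rw [← supp_congr (fun e he => (k1 e he).1), ← supp_congr (fun e he => (k2 e he).1)]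
    exact hv
  · have k1 : ∀ e ∈ C₁, ends e = ends' e ∧ sgn e = sgn' e := fun e he => h e (by simp [he])
    have k2 : ∀ e ∈ C₂, ends e = ends' e ∧ sgn e = sgn' e := fun e he => h e (by simp [he])
    have k3 : ∀ e ∈ P, ends e = ends' e := fun e he => (h e (by simp [he])).1
    have s1 := supp_congr (fun e he => (k1 e he).1)
    have s2 := supp_congr (fun e he => (k2 e he).1)
    have s3 := supp_congr k3
    rw [s1, s2] at h3
    rw [s3, s1] at h5
    rw [s3, s2] at h6
    exact Or.inr (Or.inr ⟨C₁, C₂, P, u, v, d1, d2, d3, rfl, unb_congr k1 h1, unb_congr k2 h2,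
      h3, path_congr k3 h4, h5, h6⟩)

theorem sp_congr {P : Finset E} {S : Finset V} {u v : V} (hs : SP ends P S u v)
    (h : ∀ e ∈ P, ends e = ends' e) : SP ends' P S u v := by
  induction hs with
  | nil u => exact SP.nil u
  | cons e he ha _ ih =>
    exact SP.cons e (by rw [← h e (by simp)]; exact he) ha (ih fun f hf => h f (by simp [hf]))

end congr

theorem IsPath.sp {ends : E → Sym2 V} {P : Finset E} {u v : V} (h : IsPath ends P u v) :
    SP ends P (support ends P) u v := by
  obtain ⟨h1, h2, h3, h4, h5, h6, h7, h8⟩ := h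
  obtain ⟨P', S, hP, hs⟩ := SP.of_reach (h2 u h4 v h5)
  have hsupp := hs.supp_eq h3
  have : P' = P := by
    by_contra hne
    have hn : (P \ P').Nonempty := by
      rw [Finset.nonempty_iff_ne_empty]
      intro h0
      exact hne (Finset.Subset.antisymm hP (Finset.sdiff_eq_empty_iff_subset.1 h0))
    obtain ⟨x, hx1, hx2⟩ := conn_touch (ends := ends) (A := P') (B := P \ P')
      (by rw [Finset.union_sdiff_of_subset hP]; exact h2) (hs.nonempty h3) hn
    have e1 := degree_sdiff (ends := ends) hP x
    have e2 := mt degree_zero.1 (not_not.2 hx2)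
    have e3 := hs.deg x
    have hxS : x ∈ S := by rw [← hsupp]; exact hx1
    simp only [hxS, if_true] at e3
    by_cases hxu : x = u
    · subst hxu; simp only [if_true, h3, if_false] at e3; omega
    · by_cases hxv : x = v
      · subst hxv; simp only [if_true, hxu, if_false] at e3; omega
      · have := h8 x (supp_mono hP hx1) hxu hxv
        simp only [hxu, hxv, if_false] at e3
        omega
  subst this
  rw [hsupp]; exact hs

/-- half of a barbell, attached at `v` -/
def Tail (ends : E → Sym2 V) (sgn : E → Bool) (D : Finset E) (v : V) : Prop :=
  ∃ (C P : Finset E) (S : Finset V) (w : V), IsUnbalancedCircuit ends sgn C ∧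
    SP ends P S v w ∧ S ∩ support ends C = {w} ∧ Disjoint C P ∧ D = C ∪ P

theorem Tail.congr {ends ends' : E → Sym2 V} {sgn sgn' : E → Bool} {D : Finset E} {v : V}
    (h : ∀ e ∈ D, ends e = ends' e ∧ sgn e = sgn' e) (ht : Tail ends sgn D v) :
    Tail ends' sgn' D v := by
  obtain ⟨C, P, S, w, h1, h2, h3, h4, rfl⟩ := ht
  have k1 : ∀ e ∈ C, ends e = ends' e ∧ sgn e = sgn' e := fun e he => h e (by simp [he])
  refine ⟨C, P, S, w, unb_congr k1 h1, sp_congr h2 fun e he => (h e (by simp [he])).1, ?_, h4, rfl⟩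
  rw [← supp_congr (fun e he => (k1 e he).1)]
  exact h3

theorem loop_in_circuit {ends : E → Sym2 V} {C : Finset E} {l : E} {v : V}
    (hC : IsCircuit ends C) (hl : l ∈ C) (hv : ends l = s(v, v)) : C = {l} :=
  (hC.sub_eq (loop_circuit hv) (by simpa using hl)).symm

theorem short_tail {ends : E → Sym2 V} {sgn : E → Bool} {C₁ C₂ : Finset E} {l : E} {v x : V}
    (hd : Disjoint C₁ C₂) (h1 : IsUnbalancedCircuit ends sgn C₁)
    (h2 : IsUnbalancedCircuit ends sgn C₂) (hx : support ends C₁ ∩ support ends C₂ = {x})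
    (hl : l ∈ C₁) (hv : ends l = s(v, v)) : Tail ends sgn ((C₁ ∪ C₂).erase l) v := by
  have := loop_in_circuit h1.1 hl hv
  subst this
  rw [supp_loop hv] at hx
  have hvx : v ∈ support ends C₂ := by
    have : x ∈ {v} ∩ support ends C₂ := by rw [hx]; simp
    simp only [Finset.mem_inter, Finset.mem_singleton] at this
    exact this.1 ▸ this.2
  refine ⟨C₂, ∅, {v}, v, h2, SP.nil v, Finset.singleton_inter_of_mem hvx, by simp, ?_⟩
  have : l ∉ C₂ := by simpa using hd
  ext e
  simp only [Finset.mem_erase, Finset.mem_union, Finset.mem_singleton, Finset.notMem_empty, or_false]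
  constructor
  · rintro ⟨a, b | b⟩
    · exact absurd b a
    · exact b
  · intro he
    exact ⟨fun h => this (h ▸ he), Or.inr he⟩

theorem long_tail {ends : E → Sym2 V} {sgn : E → Bool} {C₁ C₂ P : Finset E} {l : E} {v a b : V}
    (hd : Disjoint C₁ C₂) (hd1 : Disjoint C₁ P) (hd2 : Disjoint C₂ P)
    (h1 : IsUnbalancedCircuit ends sgn C₁)
    (h2 : IsUnbalancedCircuit ends sgn C₂)
    (hP : SP ends P (support ends P) a b)
    (ha : support ends P ∩ support ends C₁ = {a}) (hb : support ends P ∩ support ends C₂ = {b})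
    (hl : l ∈ C₁) (hv : ends l = s(v, v)) : Tail ends sgn ((C₁ ∪ C₂ ∪ P).erase l) v := by
  have := loop_in_circuit h1.1 hl hv
  subst this
  rw [supp_loop hv] at ha
  have hva : a = v := by
    have : a ∈ support ends P ∩ {v} := by rw [ha]; simp
    simp only [Finset.mem_inter, Finset.mem_singleton] at this
    exact this.2
  subst hva
  refine ⟨C₂, P, _, b, h2, hP, hb, hd2, ?_⟩
  have k1 : l ∉ C₂ := by simpa using hd
  have k2 : l ∉ P := by simpa using hd1
  ext e
  simp only [Finset.mem_erase, Finset.mem_union, Finset.mem_singleton]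
  constructor
  · rintro ⟨a, (b | b) | b⟩
    · exact absurd b a
    · exact Or.inl b
    · exact Or.inr b
  · rintro (he | he)
    · exact ⟨fun h => k1 (h ▸ he), Or.inl (Or.inr he)⟩
    · exact ⟨fun h => k2 (h ▸ he), Or.inr he⟩

theorem signed_tail {ends : E → Sym2 V} {sgn : E → Bool} {D : Finset E} {l : E} {v : V}
    (hD : IsSignedCircuit ends sgn D) (hl : l ∈ D) (hv : ends l = s(v, v)) (hs : sgn l = true) :
    Tail ends sgn (D.erase l) v := by
  rcases hD with hc | ⟨C₁, C₂, hd, rfl, h1, h2, x, hx⟩ |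
    ⟨C₁, C₂, P, a, b, d1, d2, d3, rfl, h1, h2, h3, h4, h5, h6⟩
  · exfalso
    have := loop_in_circuit hc.1 hl hv
    subst this
    exact Nat.not_even_iff_odd.2 (neg_loop hv hs).2 hc.2
  · rcases Finset.mem_union.1 hl with h | h
    · exact short_tail hd h1 h2 hx h hv
    · rw [Finset.union_comm]
      rw [Finset.inter_comm] at hx
      exact short_tail hd.symm h2 h1 hx h hv
  · have hP := h4.sp
    rcases Finset.mem_union.1 hl with h | h
    · rcases Finset.mem_union.1 h with h | h
      · exact long_tail d1 d2 d3 h1 h2 hP h5 h6 h hv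
      · rw [Finset.union_comm C₁ C₂]
        exact long_tail d1.symm d3 d2 h2 h1 hP.symm h6 h5 h hv
    · exact absurd hv (hP.no_loop l h v)

theorem SP.same {ends : E → Sym2 V} {P S u} (h : SP ends P S u u) : P = ∅ := by
  cases h with
  | nil => rfl
  | cons e _ ha h => exact absurd h.right_mem ha

theorem tail_sub {ends : E → Sym2 V} {C P : Finset E} {S : Finset V} {v w : V}
    (hP : SP ends P S v w) (hw : S ∩ support ends C = {w}) : S ⊆ support ends (C ∪ P) := by
  intro x hx
  rw [supp_union, Finset.mem_union]
  by_cases h : x ∈ support ends P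
  · exact Or.inr h
  · left
    have h1 := hP.deg x
    rw [degree_zero.2 h, if_pos hx] at h1
    have hxw : x = w := by
      by_contra hne
      rw [if_neg hne] at h1
      split_ifs at h1 <;> omega
    have : w ∈ S ∩ support ends C := by rw [hw]; simp
    rw [hxw]; exact (Finset.mem_inter.1 this).2

theorem Tail.glue {ends : E → Sym2 V} {sgn : E → Bool} {D₁ D₂ : Finset E} {v : V}
    (h1 : Tail ends sgn D₁ v) (h2 : Tail ends sgn D₂ v) (hd : Disjoint D₁ D₂)
    (hs : support ends D₁ ∩ support ends D₂ ⊆ {v}) : IsSignedCircuit ends sgn (D₁ ∪ D₂) := by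
  obtain ⟨C₁, P₁, S₁, w₁, u1, p1, i1, d1, rfl⟩ := h1
  obtain ⟨C₂, P₂, S₂, w₂, u2, p2, i2, d2, rfl⟩ := h2
  have t1 := tail_sub p1 i1
  have t2 := tail_sub p2 i2
  have hs' : ∀ x, x ∈ support ends (C₁ ∪ P₁) → x ∈ support ends (C₂ ∪ P₂) → x = v := by
    intro x a b
    simpa using hs (Finset.mem_inter.2 ⟨a, b⟩)
  have c1 : ∀ x, x ∈ support ends C₁ → x ∈ support ends (C₁ ∪ P₁) := fun x hx =>
    supp_mono Finset.subset_union_left hx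
  have c2 : ∀ x, x ∈ support ends C₂ → x ∈ support ends (C₂ ∪ P₂) := fun x hx =>
    supp_mono Finset.subset_union_left hx
  have j1 : ∀ x, x ∈ S₁ → x ∈ support ends C₁ → x = w₁ := fun x a b => by
    have : x ∈ S₁ ∩ support ends C₁ := Finset.mem_inter.2 ⟨a, b⟩
    rw [i1] at this; simpa using this
  have j2 : ∀ x, x ∈ S₂ → x ∈ support ends C₂ → x = w₂ := fun x a b => by
    have : x ∈ S₂ ∩ support ends C₂ := Finset.mem_inter.2 ⟨a, b⟩
    rw [i2] at this; simpa using this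
  have m1 : w₁ ∈ S₁ ∩ support ends C₁ := by rw [i1]; simp
  have m2 : w₂ ∈ S₂ ∩ support ends C₂ := by rw [i2]; simp
  rw [Finset.mem_inter] at m1 m2
  simp only [Finset.disjoint_union_left, Finset.disjoint_union_right] at hd
  have hp : SP ends (P₁ ∪ P₂) (S₁ ∪ S₂) w₁ w₂ := p1.symm.append p2 (by
    intro x hx
    rw [Finset.mem_inter] at hx
    simpa using hs' x (t1 hx.1) (t2 hx.2))
  have v1 := p1.left_mem
  have v2 := p2.left_mem
  by_cases hw : w₁ = w₂
  · have hwv : w₁ = v := hs' w₁ (c1 _ m1.2) (by rw [hw]; exact c2 _ m2.2)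
    have hw2 : w₂ = v := hw ▸ hwv
    subst hwv
    rw [hw2] at p2 m2
    have e1 := p1.same
    have e2 := p2.same
    subst e1; subst e2
    refine Or.inr (Or.inl ⟨C₁, C₂, hd.1.1, by simp, u1, u2, w₁, ?_⟩)
    ext x
    simp only [Finset.mem_inter, Finset.mem_singleton]
    constructor
    · rintro ⟨a, b⟩; exact hs' x (c1 x a) (c2 x b)
    · rintro rfl; exact ⟨m1.2, m2.2⟩
  · refine Or.inr (Or.inr ⟨C₁, C₂, P₁ ∪ P₂, w₁, w₂, hd.1.1, ?_, ?_, ?_, u1, u2, ?_, hp.isPath hw, ?_, ?_⟩)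
    · exact Finset.disjoint_union_right.2 ⟨d1, by tauto⟩
    · exact Finset.disjoint_union_right.2 ⟨by
        first | exact hd.2.1.symm | exact hd.1.2.symm, d2⟩
    · ext e; simp only [Finset.mem_union]; tauto
    · rw [Finset.disjoint_left]
      intro x a b
      have hx := hs' x (c1 x a) (c2 x b)
      subst hx
      exact hw ((j1 x v1 a).symm.trans (j2 x v2 b))
    · rw [hp.supp_eq hw]
      ext x
      simp only [Finset.mem_inter, Finset.mem_singleton, Finset.mem_union]
      constructor
      · rintro ⟨a | a, b⟩
        · exact j1 x a b
        · have hx := hs' x (c1 x b) (t2 a)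
          subst hx
          exact j1 x v1 b
      · rintro rfl; exact ⟨Or.inl m1.1, m1.2⟩
    · rw [hp.supp_eq hw]
      ext x
      simp only [Finset.mem_inter, Finset.mem_singleton, Finset.mem_union]
      constructor
      · rintro ⟨a | a, b⟩
        · have hx := hs' x (t1 a) (c2 x b)
          subst hx
          exact j2 x v2 b
        · exact j2 x a b
      · rintro rfl; exact ⟨Or.inr m2.1, m2.2⟩

theorem Tail.extend {ends : E → Sym2 V} {sgn : E → Bool} {D : Finset E} {u v : V} {p : E}
    (h : Tail ends sgn D u) (hp : ends p = s(u, v)) (hv : v ∉ support ends D) :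
    Tail ends sgn (insert p D) v := by
  obtain ⟨C, P, S, w, h1, h2, h3, h4, rfl⟩ := h
  have hS := tail_sub h2 h3
  have hvC : v ∉ support ends C := fun h => hv (supp_mono Finset.subset_union_left h)
  refine ⟨C, insert p P, insert v S, w, h1,
    SP.cons p (by rw [hp, Sym2.eq_swap]) (fun h => hv (hS h)) h2, ?_, ?_, ?_⟩
  · rw [Finset.insert_inter_of_notMem hvC, h3]
  · rw [Finset.disjoint_insert_right]
    refine ⟨fun h => hvC (mem_supp.2 ⟨p, h, by rw [hp]; simp⟩), h4⟩
  · rw [Finset.union_insert]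


/-! ### Half covers -/

/-- covers in which the members through a virtual negative loop at `v` are cut open -/
def HalfCov (ends : E → Sym2 V) (sgn : E → Bool) (N F : Finset E) (v : V) : Prop :=
  ∃ (a b c d : Finset E) (R₁ R₂ R₃ : List (Finset E)),
    (∀ D, (D = a ∨ D = b ∨ D = c ∨ D = d) → Tail ends sgn D v ∧ D ⊆ F) ∧
    (∀ C ∈ R₁, IsSignedCircuit ends sgn C ∧ C ⊆ F) ∧
    (∀ C ∈ R₂, IsSignedCircuit ends sgn C ∧ C ⊆ F) ∧
    (∀ C ∈ R₃, IsSignedCircuit ends sgn C ∧ C ⊆ F) ∧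
    (∀ e ∈ N, 1 ≤ widthAt (a :: b :: R₁) e ∧ 1 ≤ widthAt (c :: R₂) e ∧ 1 ≤ widthAt (d :: R₃) e) ∧
    (∀ e, widthAt (a :: b :: R₁) e ≤ 2 ∧ widthAt (c :: R₂) e ≤ 2 ∧ widthAt (d :: R₃) e ≤ 2 ∧
      widthAt (a :: b :: R₁) e + widthAt (c :: R₂) e + widthAt (d :: R₃) e ≤ 4) ∧
    (∀ e ∈ N, IsLoop ends e → sgn e = true → widthAt (a :: b :: R₁) e = 2)

theorem extract {ends ends' : E → Sym2 V} {sgn sgn' : E → Bool} {F : Finset E} {l : E} {v : V}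
    (hlF : l ∉ F) (hag : ∀ e ∈ F, ends' e = ends e ∧ sgn' e = sgn e)
    (hl : ends' l = s(v, v)) (hs : sgn' l = true) : ∀ (L : List (Finset E)),
    (∀ C ∈ L, IsSignedCircuit ends' sgn' C ∧ C ⊆ insert l F) →
    ∃ T R : List (Finset E), T.length = widthAt L l ∧
      (∀ D ∈ T, Tail ends sgn D v ∧ D ⊆ F) ∧
      (∀ C ∈ R, IsSignedCircuit ends sgn C ∧ C ⊆ F) ∧
      ∀ e, e ≠ l → widthAt L e = widthAt T e + widthAt R e := by
  intro L
  induction L with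
  | nil => intro _; exact ⟨[], [], rfl, by simp, by simp, by simp [widthAt_nil]⟩
  | cons C L ih =>
    intro hL
    obtain ⟨T, R, h1, h2, h3, h4⟩ := ih (fun D hD => hL D (List.mem_cons_of_mem _ hD))
    obtain ⟨hC, hCF⟩ := hL C List.mem_cons_self
    by_cases hlC : l ∈ C
    · have hsub : C.erase l ⊆ F := by
        intro e he
        rw [Finset.mem_erase] at he
        rcases Finset.mem_insert.1 (hCF he.2) with h | h
        · exact absurd h he.1
        · exact h
      refine ⟨C.erase l :: T, R, ?_, ?_, h3, ?_⟩
      · rw [List.length_cons, h1, widthAt_cons, if_pos hlC]; omega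
      · intro D hD
        rcases List.mem_cons.1 hD with rfl | hD
        · exact ⟨(signed_tail hC hlC hl hs).congr fun e he => hag e (hsub he), hsub⟩
        · exact h2 D hD
      · intro e he
        rw [widthAt_cons, widthAt_cons, h4 e he]
        have : e ∈ C.erase l ↔ e ∈ C := by simp [he]
        simp only [this]
        omega
    · have hsub : C ⊆ F := by
        intro e he
        rcases Finset.mem_insert.1 (hCF he) with h | h
        · exact absurd (h ▸ he) hlC
        · exact h
      refine ⟨T, C :: R, ?_, h2, ?_, ?_⟩
      · rw [h1, widthAt_cons, if_neg hlC]; omega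
      · intro D hD
        rcases List.mem_cons.1 hD with rfl | hD
        · exact ⟨signed_congr (fun e he => hag e (hsub he)) hC, hsub⟩
        · exact h3 D hD
      · intro e he
        rw [widthAt_cons, widthAt_cons, h4 e he]
        omega

theorem HalfCov.of_cov {ends ends' : E → Sym2 V} {sgn sgn' : E → Bool} {N F : Finset E} {l : E}
    {v : V} (hlF : l ∉ F) (hN : N ⊆ F) (hag : ∀ e ∈ F, ends' e = ends e ∧ sgn' e = sgn e)
    (hl : ends' l = s(v, v)) (hs : sgn' l = true)
    (h : Cov ends' sgn' (insert l N) (insert l F)) : HalfCov ends sgn N F v := by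
  obtain ⟨C₁, C₂, C₃, c1, c2, c3, c4, c5, c6⟩ := h
  have k1 := c6 l (by simp) (isLoop_iff.2 ⟨v, hl⟩) hs
  have k2 := c4 l (by simp)
  have k3 := c5 l
  obtain ⟨T₁, R₁, a1, a2, a3, a4⟩ := extract hlF hag hl hs C₁ c1
  obtain ⟨T₂, R₂, b1, b2, b3, b4⟩ := extract hlF hag hl hs C₂ c2
  obtain ⟨T₃, R₃, d1, d2, d3, d4⟩ := extract hlF hag hl hs C₃ c3
  obtain ⟨a, b, rfl⟩ := List.length_eq_two.1 (a1.trans k1)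
  obtain ⟨c, rfl⟩ := List.length_eq_one_iff.1 (b1.trans (by omega : _ = 1))
  obtain ⟨d, rfl⟩ := List.length_eq_one_iff.1 (d1.trans (by omega : _ = 1))
  have w1 : ∀ e, e ≠ l → widthAt (a :: b :: R₁) e = widthAt C₁ e := by
    intro e he
    rw [a4 e he]; simp only [widthAt_cons, widthAt_nil]; omega
  have w2 : ∀ e, e ≠ l → widthAt (c :: R₂) e = widthAt C₂ e := by
    intro e he
    rw [b4 e he]; simp only [widthAt_cons, widthAt_nil]; omega
  have w3 : ∀ e, e ≠ l → widthAt (d :: R₃) e = widthAt C₃ e := by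
    intro e he
    rw [d4 e he]; simp only [widthAt_cons, widthAt_nil]; omega
  have hT : ∀ D, (D = a ∨ D = b ∨ D = c ∨ D = d) → Tail ends sgn D v ∧ D ⊆ F := by
    rintro D (rfl | rfl | rfl | rfl)
    · exact a2 _ (by simp)
    · exact a2 _ (by simp)
    · exact b2 _ (by simp)
    · exact d2 _ (by simp)
  have hne : ∀ e ∈ N, e ≠ l := fun e he h => hlF (hN (h ▸ he))
  refine ⟨a, b, c, d, R₁, R₂, R₃, hT, a3, b3, d3, ?_, ?_, ?_⟩
  · intro e he
    rw [w1 e (hne e he), w2 e (hne e he), w3 e (hne e he)]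
    exact c4 e (by simp [he])
  · intro e
    by_cases he : e = l
    · subst he
      rw [widthAt_sub (F := F), widthAt_sub (F := F), widthAt_sub (F := F)]
      · simp
      · intro C hC
        rcases List.mem_cons.1 hC with rfl | hC
        · exact (hT _ (by simp)).2
        · exact (d3 C hC).2
      · exact hlF
      · intro C hC
        rcases List.mem_cons.1 hC with rfl | hC
        · exact (hT _ (by simp)).2
        · exact (b3 C hC).2
      · exact hlF
      · intro C hC
        rcases List.mem_cons.1 hC with rfl | hC
        · exact (hT _ (by simp)).2
        · rcases List.mem_cons.1 hC with rfl | hC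
          · exact (hT _ (by simp)).2
          · exact (a3 C hC).2
      · exact hlF
    · rw [w1 e he, w2 e he, w3 e he]
      exact c5 e
  · intro e he hl' hs'
    rw [w1 e (hne e he)]
    have := hag e (hN he)
    refine c6 e (by simp [he]) ?_ (by rw [this.2]; exact hs')
    unfold IsLoop at *
    rw [this.1]; exact hl'

theorem HalfCov.extend {ends : E → Sym2 V} {sgn : E → Bool} {N F : Finset E} {u v : V} {p : E}
    (h : HalfCov ends sgn N F u) (hp : ends p = s(u, v)) (hv : v ∉ support ends F) (hN : N ⊆ F) :
    HalfCov ends sgn N (insert p F) v := by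
  obtain ⟨a, b, c, d, R₁, R₂, R₃, hT, h1, h2, h3, h4, h5, h6⟩ := h
  have hpF : p ∉ F := fun h => hv (mem_supp.2 ⟨p, h, by rw [hp]; simp⟩)
  have hne : ∀ e ∈ N, e ≠ p := fun e he h => hpF (hN (h ▸ he))
  have up : ∀ R : List (Finset E), (∀ C ∈ R, IsSignedCircuit ends sgn C ∧ C ⊆ F) →
      ∀ C ∈ R, IsSignedCircuit ends sgn C ∧ C ⊆ insert p F := fun R hR C hC =>
    ⟨(hR C hC).1, (hR C hC).2.trans (Finset.subset_insert _ _)⟩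
  have w : ∀ e, e ≠ p → ∀ D : Finset E, e ∈ insert p D ↔ e ∈ D := by
    intro e he D; simp [he]
  refine ⟨insert p a, insert p b, insert p c, insert p d, R₁, R₂, R₃, ?_, up R₁ h1, up R₂ h2,
    up R₃ h3, ?_, ?_, ?_⟩
  · intro D hD
    obtain ⟨D', rfl, hD'⟩ : ∃ D', D = insert p D' ∧ (D' = a ∨ D' = b ∨ D' = c ∨ D' = d) := by
      rcases hD with rfl | rfl | rfl | rfl
      · exact ⟨a, rfl, by simp⟩
      · exact ⟨b, rfl, by simp⟩
      · exact ⟨c, rfl, by simp⟩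
      · exact ⟨d, rfl, by simp⟩
    obtain ⟨k1, k2⟩ := hT D' hD'
    exact ⟨k1.extend hp fun h => hv (supp_mono k2 h), Finset.insert_subset_insert _ k2⟩
  · intro e he
    have := h4 e he
    simp only [widthAt_cons, w e (hne e he)] at *
    exact this
  · intro e
    by_cases he : e = p
    · subst he
      have z1 := widthAt_sub (fun C hC => (h1 C hC).2) hpF
      have z2 := widthAt_sub (fun C hC => (h2 C hC).2) hpF
      have z3 := widthAt_sub (fun C hC => (h3 C hC).2) hpF
      simp [widthAt_cons, z1, z2, z3]
    · have := h5 e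
      simp only [widthAt_cons, w e he] at *
      exact this
  · intro e he hl hs
    have := h6 e he hl hs
    simp only [widthAt_cons, w e (hne e he)] at *
    exact this

theorem HalfCov.glue {ends : E → Sym2 V} {sgn : E → Bool} {N₁ F₁ N₂ F₂ : Finset E} {v : V}
    (h1 : HalfCov ends sgn N₁ F₁ v) (h2 : HalfCov ends sgn N₂ F₂ v) (hd : Disjoint F₁ F₂)
    (hs : support ends F₁ ∩ support ends F₂ ⊆ {v}) (hN₁ : N₁ ⊆ F₁) (hN₂ : N₂ ⊆ F₂) :
    Cov ends sgn (N₁ ∪ N₂) (F₁ ∪ F₂) := by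
  obtain ⟨a, b, c, d, R₁, R₂, R₃, hT, a1, a2, a3, a4, a5, a6⟩ := h1
  obtain ⟨a', b', c', d', R₁', R₂', R₃', hT', b1, b2, b3, b4, b5, b6⟩ := h2
  have gl : ∀ D D', (D = a ∨ D = b ∨ D = c ∨ D = d) → (D' = a' ∨ D' = b' ∨ D' = c' ∨ D' = d') →
      IsSignedCircuit ends sgn (D ∪ D') ∧ D ∪ D' ⊆ F₁ ∪ F₂ := by
    intro D D' hD hD'
    obtain ⟨t, hDF⟩ := hT D hD
    obtain ⟨t', hDF'⟩ := hT' D' hD'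
    refine ⟨t.glue t' (Finset.disjoint_of_subset_left hDF (Finset.disjoint_of_subset_right hDF' hd))
      ((Finset.inter_subset_inter (supp_mono hDF) (supp_mono hDF')).trans hs),
      Finset.union_subset_union hDF hDF'⟩
  have app : ∀ A B : List (Finset E), (∀ C ∈ A, IsSignedCircuit ends sgn C ∧ C ⊆ F₁) →
      (∀ C ∈ B, IsSignedCircuit ends sgn C ∧ C ⊆ F₂) →
      ∀ C ∈ A ++ B, IsSignedCircuit ends sgn C ∧ C ⊆ F₁ ∪ F₂ := by
    intro A B hA hB C hC
    rcases List.mem_append.1 hC with h | h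
    · exact ⟨(hA C h).1, (hA C h).2.trans Finset.subset_union_left⟩
    · exact ⟨(hB C h).1, (hB C h).2.trans Finset.subset_union_right⟩
  have sub1 : ∀ e, e ∉ F₁ → e ∉ a ∧ e ∉ b ∧ e ∉ c ∧ e ∉ d ∧
      widthAt R₁ e = 0 ∧ widthAt R₂ e = 0 ∧ widthAt R₃ e = 0 := fun e he =>
    ⟨fun h => he ((hT a (by simp)).2 h), fun h => he ((hT b (by simp)).2 h),
     fun h => he ((hT c (by simp)).2 h), fun h => he ((hT d (by simp)).2 h),
     widthAt_sub (fun C h => (a1 C h).2) he, widthAt_sub (fun C h => (a2 C h).2) he,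
     widthAt_sub (fun C h => (a3 C h).2) he⟩
  have sub2 : ∀ e, e ∉ F₂ → e ∉ a' ∧ e ∉ b' ∧ e ∉ c' ∧ e ∉ d' ∧
      widthAt R₁' e = 0 ∧ widthAt R₂' e = 0 ∧ widthAt R₃' e = 0 := fun e he =>
    ⟨fun h => he ((hT' a' (by simp)).2 h), fun h => he ((hT' b' (by simp)).2 h),
     fun h => he ((hT' c' (by simp)).2 h), fun h => he ((hT' d' (by simp)).2 h),
     widthAt_sub (fun C h => (b1 C h).2) he, widthAt_sub (fun C h => (b2 C h).2) he,
     widthAt_sub (fun C h => (b3 C h).2) he⟩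
  have w1 : ∀ e, e ∉ F₂ →
      widthAt ((a ∪ a') :: (b ∪ b') :: (R₁ ++ R₁')) e = widthAt (a :: b :: R₁) e ∧
      widthAt ((c ∪ c') :: (R₂ ++ R₂')) e = widthAt (c :: R₂) e ∧
      widthAt ((d ∪ d') :: (R₃ ++ R₃')) e = widthAt (d :: R₃) e := by
    intro e he
    obtain ⟨x1, x2, x3, x4, x5, x6, x7⟩ := sub2 e he
    simp [widthAt_cons, widthAt_append, x1, x2, x3, x4, x5, x6, x7]
  have w2 : ∀ e, e ∉ F₁ →
      widthAt ((a ∪ a') :: (b ∪ b') :: (R₁ ++ R₁')) e = widthAt (a' :: b' :: R₁') e ∧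
      widthAt ((c ∪ c') :: (R₂ ++ R₂')) e = widthAt (c' :: R₂') e ∧
      widthAt ((d ∪ d') :: (R₃ ++ R₃')) e = widthAt (d' :: R₃') e := by
    intro e he
    obtain ⟨x1, x2, x3, x4, x5, x6, x7⟩ := sub1 e he
    simp [widthAt_cons, widthAt_append, x1, x2, x3, x4, x5, x6, x7]
  refine ⟨(a ∪ a') :: (b ∪ b') :: (R₁ ++ R₁'), (c ∪ c') :: (R₂ ++ R₂'), (d ∪ d') :: (R₃ ++ R₃'),
    ?_, ?_, ?_, ?_, ?_, ?_⟩
  · intro C hC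
    rcases List.mem_cons.1 hC with rfl | hC
    · exact gl _ _ (by simp) (by simp)
    · rcases List.mem_cons.1 hC with rfl | hC
      · exact gl _ _ (by simp) (by simp)
      · exact app _ _ a1 b1 C hC
  · intro C hC
    rcases List.mem_cons.1 hC with rfl | hC
    · exact gl _ _ (by simp) (by simp)
    · exact app _ _ a2 b2 C hC
  · intro C hC
    rcases List.mem_cons.1 hC with rfl | hC
    · exact gl _ _ (by simp) (by simp)
    · exact app _ _ a3 b3 C hC
  · intro e he
    rcases Finset.mem_union.1 he with h | h
    · obtain ⟨y1, y2, y3⟩ := w1 e (Finset.disjoint_left.1 hd (hN₁ h))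
      rw [y1, y2, y3]; exact a4 e h
    · obtain ⟨y1, y2, y3⟩ := w2 e (Finset.disjoint_right.1 hd (hN₂ h))
      rw [y1, y2, y3]; exact b4 e h
  · intro e
    by_cases h : e ∈ F₁
    · obtain ⟨y1, y2, y3⟩ := w1 e (Finset.disjoint_left.1 hd h)
      rw [y1, y2, y3]; exact a5 e
    · obtain ⟨y1, y2, y3⟩ := w2 e h
      rw [y1, y2, y3]; exact b5 e
  · intro e he hl hs'
    rcases Finset.mem_union.1 he with h | h
    · rw [(w1 e (Finset.disjoint_left.1 hd (hN₁ h))).1]; exact a6 e h hl hs'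
    · rw [(w2 e (Finset.disjoint_right.1 hd (hN₂ h))).1]; exact b6 e h hl hs'


/-! ### Main induction -/

/-- the induction statement -/
def Main (V E : Type) [Fintype V] [Fintype E] [DecidableEq V] [DecidableEq E] (n : ℕ) : Prop :=
  ∀ (ends : E → Sym2 V) (sgn : E → Bool) (N P : Finset E), N.card + P.card ≤ n → Disjoint N P →
    ConnectedOn ends (N ∪ P) → EvenOn ends N → Even (negEdges sgn N).card → Cov ends sgn N (N ∪ P)

theorem neg_union {sgn : E → Bool} {A B : Finset E} (h : Disjoint A B) :
    (negEdges sgn (A ∪ B)).card = (negEdges sgn A).card + (negEdges sgn B).card := by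
  unfold negEdges
  rw [Finset.filter_union, Finset.card_union_of_disjoint]
  exact Finset.disjoint_filter_filter h

theorem virtual {n : ℕ} (IH : Main V E n) {ends : E → Sym2 V} {sgn : E → Bool} {N P : Finset E}
    {v : V} {l : E} (hsz : N.card + P.card + 1 ≤ n) (hd : Disjoint N P)
    (hc : ConnectedOn ends (N ∪ P)) (he : EvenOn ends N) (ho : Odd (negEdges sgn N).card)
    (hv : v ∈ support ends (N ∪ P)) (hl : l ∉ N ∪ P) : HalfCov ends sgn N (N ∪ P) v := by
  have hlN : l ∉ N := fun h => hl (Finset.mem_union_left _ h)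
  have hlP : l ∉ P := fun h => hl (Finset.mem_union_right _ h)
  have hag : ∀ e ∈ N ∪ P, Function.update ends l s(v, v) e = ends e ∧
      Function.update sgn l true e = sgn e := by
    intro e he
    have : e ≠ l := fun h => hl (h ▸ he)
    simp [this]
  have hel : Function.update ends l s(v, v) l = s(v, v) := by simp
  have hsl : Function.update sgn l true l = true := by simp
  generalize Function.update ends l s(v, v) = ends' at hag hel
  generalize Function.update sgn l true = sgn' at hag hsl
  refine HalfCov.of_cov hl Finset.subset_union_left hag hel hsl ?_
  rw [← Finset.insert_union]
  apply IH
  · rw [Finset.card_insert_of_notMem hlN]; omega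
  · rw [Finset.disjoint_insert_left]; exact ⟨hlP, hd⟩
  · rw [Finset.insert_union, Finset.insert_eq]
    refine conn_union (v := v) (conn_single l) ?_ ?_ ?_
    · exact conn_congr (fun e he => (hag e he).1.symm) hc
    · rw [supp_loop hel]; simp
    · rw [← supp_congr fun e he => (hag e he).1.symm]; exact hv
  · intro w
    rw [degree_insert hel hlN, ← deg_congr fun e he => (hag e (Finset.mem_union_left _ he)).1.symm]
    have := he w
    split_ifs <;> simpa [parity_simps] using this
  · rw [Finset.insert_eq, neg_union (by simpa using hlN),
      ← neg_congr (F := N) fun e he => (hag e (Finset.mem_union_left _ he)).2.symm]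
    have : (negEdges sgn' {l}).card = 1 := by simp [negEdges, hsl, Finset.filter_singleton]
    rw [this, add_comm]
    exact ho.add_one

theorem even_part {ends : E → Sym2 V} {N G : Finset E} (h : G ⊆ N) (hN : EvenOn ends N) {w : V}
    (hw : w ∈ support ends G → w ∉ support ends (N \ G)) : Even (degree ends G w) := by
  by_cases h1 : w ∈ support ends G
  · have := degree_sdiff h w (ends := ends)
    rw [degree_zero.2 (hw h1), zero_add] at this
    rw [this]; exact hN w
  · rw [degree_zero.2 h1]; simp

theorem case_A {n : ℕ} (IH : Main V E n) {ends : E → Sym2 V} {sgn : E → Bool} {N P : Finset E}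
    (hsz : N.card + P.card ≤ n + 1) (hd : Disjoint N P)
    (hc : ConnectedOn ends (N ∪ P)) (he : EvenOn ends N) (hev : Even (negEdges sgn N).card)
    (hP : P.Nonempty) : Cov ends sgn N (N ∪ P) := by
  obtain ⟨p, hp⟩ := hP
  obtain ⟨u, v, huv⟩ := exists_ends ends p
  have hpN : p ∉ N := fun h => Finset.disjoint_left.1 hd h hp
  have hpF : p ∈ N ∪ P := Finset.mem_union_right _ hp
  set F' := (N ∪ P).erase p with hF'
  have hF'e : F' = N ∪ P.erase p := by
    rw [hF', Finset.erase_union_distrib, Finset.erase_eq_of_notMem hpN]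
  have hNF' : N ⊆ F' := by rw [hF'e]; exact Finset.subset_union_left
  have hcardP : (P.erase p).card + 1 = P.card := Finset.card_erase_add_one hp
  have hstep : ∀ (S : V → Prop), (∀ e ∈ F', ∀ a b, ends e = s(a, b) → S a → S b) →
      (S u ↔ S v) → ∀ x y, Reach ends (N ∪ P) x y → S x → S y := by
    intro S h1 h2 x y hr hx
    refine reach_closed S ?_ hr hx
    intro e he a b hab ha
    by_cases hep : e = p
    · subst hep
      rw [huv] at hab
      rcases Sym2.eq_iff.1 hab with ⟨rfl, rfl⟩ | ⟨rfl, rfl⟩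
      · exact h2.1 ha
      · exact h2.2 ha
    · exact h1 e (Finset.mem_erase.2 ⟨hep, he⟩) a b hab ha
  have huF : u ∈ support ends (N ∪ P) := mem_supp.2 ⟨p, hpF, by simp [huv]⟩
  have hsubF : F' ⊆ N ∪ P := Finset.erase_subset _ _
  have hext : ∀ {x a b : V} {e}, e ∈ F' → ends e = s(a, b) → Reach ends F' x a → Reach ends F' x b :=
    fun he hab hr => reach_trans hr (reach_edge he (by simp [hab]) (by simp [hab]))
  by_cases hr : Reach ends F' u v
  · have hconn : ConnectedOn ends F' := by
      intro x hx y hy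
      refine hstep (fun z => Reach ends F' x z) (fun e he a b hab => hext he hab)
        ⟨fun h => reach_trans h hr, fun h => reach_trans h (reach_symm hr)⟩ x y
        (hc x (supp_mono hsubF hx) y (supp_mono hsubF hy)) Relation.ReflTransGen.refl
    suffices h : Cov ends sgn N F' from h.mono hsubF
    rw [hF'e]
    refine IH ends sgn N (P.erase p) (by omega)
      (Finset.disjoint_of_subset_right (Finset.erase_subset _ _) hd) (hF'e ▸ hconn) he hev
  set Fu := comp ends F' u
  set Fv := comp ends F' v
  have hsd : ∀ x, x ∈ support ends Fu → x ∉ support ends Fv := fun x h1 h2 =>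
    hr (reach_trans (comp_supp h1) (reach_symm (comp_supp h2)))
  have hdis : Disjoint Fu Fv := by
    rw [Finset.disjoint_left]
    intro e h1 h2
    obtain ⟨a, b, hab⟩ := exists_ends ends e
    exact hsd a (mem_supp.2 ⟨e, h1, by simp [hab]⟩) (mem_supp.2 ⟨e, h2, by simp [hab]⟩)
  have hun : F' = Fu ∪ Fv := by
    refine Finset.Subset.antisymm ?_ (Finset.union_subset comp_sub comp_sub)
    intro e he
    obtain ⟨a, b, hab⟩ := exists_ends ends e
    have ha : a ∈ support ends (N ∪ P) := mem_supp.2 ⟨e, hsubF he, by simp [hab]⟩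
    have := hstep (fun z => Reach ends F' u z ∨ Reach ends F' v z)
      (fun e he a b hab h => h.imp (hext he hab) (hext he hab))
      ⟨fun _ => Or.inr Relation.ReflTransGen.refl, fun _ => Or.inl Relation.ReflTransGen.refl⟩ u a
      (hc u huF a ha) (Or.inl Relation.ReflTransGen.refl)
    rcases this with h | h
    · exact Finset.mem_union_left _ (mem_comp he (by simp [hab]) h)
    · exact Finset.mem_union_right _ (mem_comp he (by simp [hab]) h)
  have hNu : N = (N ∩ Fu) ∪ (N ∩ Fv) := by
    rw [← Finset.inter_union_distrib_left, ← hun, Finset.inter_eq_left.2 hNF']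
  have hFuF : Fu ⊆ F' := comp_sub
  have hFvF : Fv ⊆ F' := comp_sub
  have hsplit : ∀ X ⊆ F', X = (N ∩ X) ∪ (P ∩ X) := by
    intro X hX
    rw [← Finset.union_inter_distrib_right, Finset.inter_eq_right.2 (hX.trans hsubF)]
  have hNd : Disjoint (N ∩ Fu) (N ∩ Fv) :=
    Finset.disjoint_of_subset_left Finset.inter_subset_right
      (Finset.disjoint_of_subset_right Finset.inter_subset_right hdis)
  have heu : EvenOn ends (N ∩ Fu) := by
    intro w
    refine even_part Finset.inter_subset_left he fun h1 h2 => ?_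
    refine hsd w (supp_mono Finset.inter_subset_right h1) (supp_mono ?_ h2)
    intro e; simp only [Finset.mem_sdiff, Finset.mem_inter]
    intro ⟨h, h'⟩
    have := hNF' h; rw [hun, Finset.mem_union] at this; tauto
  have hev' : EvenOn ends (N ∩ Fv) := by
    intro w
    refine even_part Finset.inter_subset_left he fun h1 h2 => ?_
    refine hsd w (supp_mono ?_ h2) (supp_mono Finset.inter_subset_right h1)
    intro e; simp only [Finset.mem_sdiff, Finset.mem_inter]
    intro ⟨h, h'⟩
    have := hNF' h; rw [hun, Finset.mem_union] at this; tauto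
  have hdX : ∀ X, Disjoint (N ∩ X) (P ∩ X) := fun X =>
    Finset.disjoint_of_subset_left Finset.inter_subset_left
      (Finset.disjoint_of_subset_right Finset.inter_subset_left hd)
  have hcX : ∀ X ⊆ F', (N ∩ X).card + (P ∩ X).card = X.card := by
    intro X hX
    rw [← Finset.card_union_of_disjoint (hdX X), ← hsplit X hX]
  have hFc : Fu.card + Fv.card = F'.card := by
    rw [hun, Finset.card_union_of_disjoint hdis]
  have hF'c : F'.card + 1 = N.card + P.card := by
    rw [hF', Finset.card_erase_add_one hpF, Finset.card_union_of_disjoint hd]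
  have hcu := hcX Fu hFuF
  have hcv := hcX Fv hFvF
  have hneg := hev
  rw [hNu, neg_union hNd] at hneg
  have hpF' : p ∉ F' := Finset.notMem_erase _ _
  by_cases hpar : Even (negEdges sgn (N ∩ Fu)).card
  · have hpar2 : Even (negEdges sgn (N ∩ Fv)).card := (Nat.even_add.1 hneg).1 hpar
    have h1 := IH ends sgn (N ∩ Fu) (P ∩ Fu) (by omega) (hdX _)
      (by rw [← hsplit Fu hFuF]; exact comp_conn) heu hpar
    have h2 := IH ends sgn (N ∩ Fv) (P ∩ Fv) (by omega) (hdX _)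
      (by rw [← hsplit Fv hFvF]; exact comp_conn) hev' hpar2
    rw [← hsplit Fu hFuF] at h1
    rw [← hsplit Fv hFvF] at h2
    have h3 := Cov.combine h1 h2 hdis Finset.inter_subset_right Finset.inter_subset_right
    rw [← hNu, ← hun] at h3
    exact h3.mono hsubF
  · have hpar2 : ¬ Even (negEdges sgn (N ∩ Fv)).card := fun h => hpar ((Nat.even_add.1 hneg).2 h)
    have hne : ∀ X, ¬ Even (negEdges sgn (N ∩ X)).card → ∃ e, e ∈ X := by
      intro X hX
      by_contra hcon
      apply hX
      push Not at hcon
      rw [Finset.eq_empty_of_forall_notMem hcon]; simp [negEdges]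
    have hmem : ∀ z, (∃ e, e ∈ comp ends F' z) → z ∈ support ends (comp ends F' z) := by
      rintro z ⟨e, he⟩
      obtain ⟨a, b, hab⟩ := exists_ends ends e
      have ha : a ∈ support ends (comp ends F' z) := mem_supp.2 ⟨e, he, by simp [hab]⟩
      rcases reach_supp (comp_reach (comp_supp ha)) with h | h
      · exact h.symm ▸ ha
      · exact h.1
    have hu := hmem u (hne Fu hpar)
    have hv := hmem v (hne Fv hpar2)
    rw [Nat.not_even_iff_odd] at hpar hpar2
    have hpos : ∀ X : Finset E, (∃ e, e ∈ X) → 0 < X.card := fun X ⟨e, he⟩ => Finset.card_pos.2 ⟨e, he⟩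
    have hp1 := hpos Fu (hne Fu (by rwa [Nat.not_even_iff_odd]))
    have hp2 := hpos Fv (hne Fv (by rwa [Nat.not_even_iff_odd]))
    have h1 := virtual IH (l := p) (v := u) (N := N ∩ Fu) (P := P ∩ Fu) (by omega) (hdX _)
      (by rw [← hsplit Fu hFuF]; exact comp_conn) heu hpar
      (by rw [← hsplit Fu hFuF]; exact hu) (by rw [← hsplit Fu hFuF]; exact fun h => hpF' (hFuF h))
    have h2 := virtual IH (l := p) (v := v) (N := N ∩ Fv) (P := P ∩ Fv) (by omega) (hdX _)
      (by rw [← hsplit Fv hFvF]; exact comp_conn) hev' hpar2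
      (by rw [← hsplit Fv hFvF]; exact hv) (by rw [← hsplit Fv hFvF]; exact fun h => hpF' (hFvF h))
    rw [← hsplit Fu hFuF] at h1
    rw [← hsplit Fv hFvF] at h2
    have h3 := HalfCov.extend h1 huv (fun h => hsd v h hv) Finset.inter_subset_right
    have h4 := HalfCov.glue h3 h2 (by
      rw [Finset.disjoint_insert_left]; exact ⟨fun h => hpF' (hFvF h), hdis⟩) (by
      intro x hx
      rw [Finset.mem_inter, Finset.insert_eq, supp_union, Finset.mem_union] at hx
      rcases hx with ⟨h | h, h'⟩
      · obtain ⟨e, he, hx⟩ := mem_supp.1 h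
        rw [Finset.mem_singleton] at he; subst he
        rw [huv, Sym2.mem_iff] at hx
        rcases hx with rfl | rfl
        · exact absurd h' (hsd _ hu)
        · simp
      · exact absurd h' (hsd _ h)) (Finset.inter_subset_right.trans (Finset.subset_insert _ _))
        Finset.inter_subset_right
    rw [← hNu] at h4
    refine h4.mono ?_
    intro e he
    rw [Finset.mem_union, Finset.mem_insert] at he
    rcases he with (rfl | h) | h
    · exact hpF
    · exact hsubF (hFuF h)
    · exact hsubF (hFvF h)

theorem split_conn {ends : E → Sym2 V} {N₁ N₂ : Finset E} {v : V}
    (hc : ConnectedOn ends (N₁ ∪ N₂)) (h2 : N₂.Nonempty)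
    (hs : support ends N₁ ∩ support ends N₂ ⊆ {v}) : ConnectedOn ends N₁ := by
  have key : ∀ x ∈ support ends N₁, Reach ends N₁ x v := by
    intro x hx
    have h1 : N₁.Nonempty := by obtain ⟨e, he, _⟩ := mem_supp.1 hx; exact ⟨e, he⟩
    obtain ⟨z, hz1, hz2⟩ := conn_touch hc h1 h2
    have hzv : z = v := by simpa using hs (Finset.mem_inter.2 ⟨hz1, hz2⟩)
    subst hzv
    have := reach_closed (fun y => Reach ends N₁ x y ∨ Reach ends N₁ x z) (u := x) (v := z)
      (ends := ends) (F := N₁ ∪ N₂) (by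
        intro e he a b hab h
        rcases h with h | h
        · rw [Finset.mem_union] at he
          rcases he with he | he
          · exact Or.inl (reach_trans h (reach_edge he (by simp [hab]) (by simp [hab])))
          · have ha2 : a ∈ support ends N₂ := mem_supp.2 ⟨e, he, by simp [hab]⟩
            have ha1 : a ∈ support ends N₁ := by
              rcases reach_supp h with h | h
              · rwa [← h]
              · exact h.2
            have : a = z := by simpa using hs (Finset.mem_inter.2 ⟨ha1, ha2⟩)
            subst this
            exact Or.inr h
        · exact Or.inr h)
      (hc x (by rw [supp_union]; exact Finset.mem_union_left _ hx) z
        (by rw [supp_union]; exact Finset.mem_union_left _ hz1)) (Or.inl Relation.ReflTransGen.refl)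
    tauto
  intro x hx y hy
  exact reach_trans (key x hx) (reach_symm (key y hy))

theorem split_even {ends : E → Sym2 V} {N₁ N₂ : Finset E} {v : V} (hd : Disjoint N₁ N₂)
    (he : EvenOn ends (N₁ ∪ N₂)) 
    (hs : support ends N₁ ∩ support ends N₂ ⊆ {v}) : EvenOn ends N₁ := by
  have key : ∀ w, w ≠ v → Even (degree ends N₁ w) := by
    intro w hw
    refine even_part Finset.subset_union_left he fun h1 h2 => hw ?_
    rw [Finset.union_sdiff_cancel_left hd] at h2
    simpa using hs (Finset.mem_inter.2 ⟨h1, h2⟩)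
  intro w
  by_cases hw : w = v
  · subst hw
    by_contra hcon
    rw [Nat.not_even_iff_odd] at hcon
    obtain ⟨z, hz, ho, _⟩ := odd_reach hcon
    exact Nat.not_even_iff_odd.2 ho (key z hz)
  · exact key w hw

theorem case_B {n : ℕ} (IH : Main V E n) {ends : E → Sym2 V} {sgn : E → Bool} {N₁ N₂ : Finset E}
    {v : V} (hsz : (N₁ ∪ N₂).card ≤ n + 1) (hd : Disjoint N₁ N₂)
    (hc : ConnectedOn ends (N₁ ∪ N₂)) (he : EvenOn ends (N₁ ∪ N₂))
    (hev : Even (negEdges sgn (N₁ ∪ N₂)).card) (h1 : N₁.Nonempty) (h2 : N₂.Nonempty)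
    (hs : support ends N₁ ∩ support ends N₂ ⊆ {v})
    (hbig : Even (negEdges sgn N₁).card ∨ (1 < N₁.card ∧ 1 < N₂.card)) :
    Cov ends sgn (N₁ ∪ N₂) (N₁ ∪ N₂) := by
  have hc1 := split_conn hc h2 hs
  have hc2 : ConnectedOn ends N₂ := split_conn (N₂ := N₁) (v := v) (by rwa [Finset.union_comm]) h1
    (by rwa [Finset.inter_comm])
  have he1 := split_even hd he hs
  have he2 : EvenOn ends N₂ := split_even (N₂ := N₁) (v := v) hd.symm (by rwa [Finset.union_comm])
    (by rwa [Finset.inter_comm])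
  rw [Finset.card_union_of_disjoint hd] at hsz
  rw [neg_union hd] at hev
  have hp1 := Finset.card_pos.2 h1
  have hp2 := Finset.card_pos.2 h2
  by_cases hpar : Even (negEdges sgn N₁).card
  · have hpar2 := (Nat.even_add.1 hev).1 hpar
    have a1 := IH ends sgn N₁ ∅ (by simp; omega) (by simp) (by simpa using hc1) he1 hpar
    have a2 := IH ends sgn N₂ ∅ (by simp; omega) (by simp) (by simpa using hc2) he2 hpar2
    rw [Finset.union_empty] at a1 a2
    exact Cov.combine a1 a2 hd (Finset.Subset.refl _) (Finset.Subset.refl _)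
  · have hpar2 : ¬ Even (negEdges sgn N₂).card := fun h => hpar ((Nat.even_add.1 hev).2 h)
    rw [Nat.not_even_iff_odd] at hpar2
    obtain ⟨hb1, hb2⟩ := hbig.resolve_left hpar
    rw [Nat.not_even_iff_odd] at hpar
    obtain ⟨z, hz1, hz2⟩ := conn_touch hc h1 h2
    have hzv : z = v := by simpa using hs (Finset.mem_inter.2 ⟨hz1, hz2⟩)
    subst hzv
    obtain ⟨e1, m1⟩ := h1
    obtain ⟨e2, m2⟩ := h2
    have a1 := virtual IH (N := N₁) (P := ∅) (v := z) (l := e2) (by simp; omega) (by simp)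
      (by simpa using hc1) he1 hpar (by simpa using hz1)
      (by simpa using fun h => Finset.disjoint_left.1 hd h m2)
    have a2 := virtual IH (N := N₂) (P := ∅) (v := z) (l := e1) (by simp; omega) (by simp)
      (by simpa using hc2) he2 hpar2 (by simpa using hz2)
      (by simpa using fun h => Finset.disjoint_left.1 hd m1 h)
    rw [Finset.union_empty] at a1 a2
    exact HalfCov.glue a1 a2 hd hs (Finset.Subset.refl _) (Finset.Subset.refl _)


theorem loops_even {ends : E → Sym2 V} {L : Finset E} (h : ∀ e ∈ L, IsLoop ends e) :
    EvenOn ends L := by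
  intro v
  rw [degree_eq]
  refine Finset.even_sum _ fun e he => ?_
  obtain ⟨x, hx⟩ := isLoop_iff.1 (h e he)
  rw [inc_eq hx]
  exact ⟨_, rfl⟩

theorem neg_image {ends : E → Sym2 V} {sgn : E → Bool} {M : Finset V} {l : V → E}
    (hl : ∀ x ∈ M, ends (l x) = s(x, x) ∧ sgn (l x) = true) :
    (negEdges sgn (M.image l)).card = M.card := by
  have : negEdges sgn (M.image l) = M.image l := by
    unfold negEdges
    rw [Finset.filter_eq_self]
    intro e he
    obtain ⟨x, hx, rfl⟩ := Finset.mem_image.1 he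
    exact (hl x hx).2
  rw [this]
  apply Finset.card_image_of_injOn
  intro x hx y hy hxy
  have h1 := (hl x hx).1
  have h2 := (hl y hy).1
  have hxy' : l x = l y := hxy
  rw [hxy', h2] at h1
  have : y ∈ s(x, x) := by rw [← h1]; simp
  have h3 : y = x := by simpa using this
  exact h3.symm

theorem conn_loops {ends : E → Sym2 V} {K L : Finset E} (hK : ConnectedOn ends K)
    (h : ∀ e ∈ L, ∃ v ∈ support ends K, ends e = s(v, v)) : ConnectedOn ends (K ∪ L) := by
  have key : ∀ x ∈ support ends (K ∪ L), x ∈ support ends K := by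
    intro x hx
    rw [supp_union, Finset.mem_union] at hx
    rcases hx with hx | hx
    · exact hx
    · obtain ⟨e, he, hxe⟩ := mem_supp.1 hx
      obtain ⟨v, hv, hev⟩ := h e he
      rw [hev] at hxe
      have : x = v := by simpa using hxe
      rwa [this]
  intro x hx y hy
  exact reach_mono Finset.subset_union_left (hK x (key x hx) y (key y hy))

theorem even_single {ends : E → Sym2 V} {e : E} (h : EvenOn ends {e}) : IsLoop ends e := by
  obtain ⟨a, b, hab⟩ := exists_ends ends e
  rw [isLoop_iff]
  by_contra hcon
  push Not at hcon
  have hne : a ≠ b := fun h => hcon a (by rw [hab, h])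
  have := h a
  rw [degree_eq, Finset.sum_singleton, inc_eq hab] at this
  simp [hne] at this

/-- irreducibility -/
def Irr (ends : E → Sym2 V) (sgn : E → Bool) (N : Finset E) : Prop :=
  ∀ N₁ ⊆ N, N₁.Nonempty → (N \ N₁).Nonempty → ∀ v,
    support ends N₁ ∩ support ends (N \ N₁) ⊆ {v} →
      ¬ Even (negEdges sgn N₁).card ∧ (N₁.card ≤ 1 ∨ (N \ N₁).card ≤ 1)

theorem neg_single {sgn : E → Bool} {e : E} :
    (negEdges sgn {e}).card = if sgn e = true then 1 else 0 := by
  unfold negEdges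
  rw [Finset.filter_singleton]
  split_ifs <;> simp

theorem Irr.loop_neg {ends : E → Sym2 V} {sgn : E → Bool} {N : Finset E} (h : Irr ends sgn N)
    {e : E} {v : V} (he : e ∈ N) (hv : ends e = s(v, v)) (hne : N ≠ {e}) : sgn e = true := by
  have := (h {e} (by simpa using he) (by simp) (by
    rw [Finset.sdiff_nonempty]
    intro hs
    exact hne (Finset.Subset.antisymm hs (by simpa using he))) v (by
      rw [supp_loop hv]; exact Finset.inter_subset_left)).1
  rw [neg_single] at this
  by_contra hcon
  simp [hcon] at this

theorem Irr.loop_uniq {ends : E → Sym2 V} {sgn : E → Bool} {N : Finset E} (h : Irr ends sgn N)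
    {e f : E} {v : V} (he : e ∈ N) (hf : f ∈ N) (hve : ends e = s(v, v)) (hvf : ends f = s(v, v))
    (hef : e ≠ f) : N = {e, f} ∧ sgn e = true ∧ sgn f = true := by
  have h1 : sgn e = true := h.loop_neg he hve (by
    intro hN; rw [hN, Finset.mem_singleton] at hf; exact hef hf.symm)
  have h2 : sgn f = true := h.loop_neg hf hvf (by
    intro hN; rw [hN, Finset.mem_singleton] at he; exact hef he)
  refine ⟨?_, h1, h2⟩
  by_contra hne
  have hsub : ({e, f} : Finset E) ⊆ N := by
    intro x; simp only [Finset.mem_insert, Finset.mem_singleton]; rintro (rfl | rfl) <;> assumption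
  have := (h {e, f} hsub (by simp) (by
    rw [Finset.sdiff_nonempty]
    intro hs
    exact hne (Finset.Subset.antisymm hs hsub)) v (by
      rw [Finset.insert_eq, supp_union, supp_loop hve, supp_loop hvf, Finset.union_self]
      exact Finset.inter_subset_left)).1
  rw [Finset.insert_eq, neg_union (by simpa using hef), neg_single, neg_single, if_pos h1, if_pos h2] at this
  exact this (by decide)

theorem cov_empty {ends : E → Sym2 V} {sgn : E → Bool} : Cov ends sgn ∅ ∅ :=
  ⟨[], [], [], by simp, by simp, by simp, by simp, by simp [widthAt_nil], by simp⟩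

theorem case_loops {ends : E → Sym2 V} {sgn : E → Bool} {N : Finset E} (hirr : Irr ends sgn N)
    (hc : ConnectedOn ends N) (hev : Even (negEdges sgn N).card)
    (hL : ∀ e ∈ N, IsLoop ends e) : Cov ends sgn N N := by
  rcases N.eq_empty_or_nonempty with rfl | ⟨e, he⟩
  · exact cov_empty
  obtain ⟨v, hv⟩ := isLoop_iff.1 (hL e he)
  by_cases hN : N = {e}
  · have hs : sgn e = false := by
      rw [hN, neg_single] at hev
      cases hh : sgn e with
      | false => rfl
      | true => rw [if_pos hh] at hev; exact absurd hev (by decide)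
    have hb : IsSignedCircuit ends sgn N := by
      left
      rw [hN]
      exact ⟨loop_circuit hv, by rw [neg_single]; simp [hs]⟩
    refine Cov.of (C₁ := [N]) (C₂ := [N]) (C₃ := [N]) (by simpa using hb) (by simpa using hb)
      (by simpa using hb) ?_
    intro x hx
    simp only [widthAt_cons, widthAt_nil, hx, if_true]
    refine ⟨by omega, by omega, ?_⟩
    rw [hN, Finset.mem_singleton] at hx
    subst hx
    intro _ h
    rw [hs] at h; cases h
  · have hne : (N \ {e}).Nonempty := by
      rw [Finset.sdiff_nonempty]
      intro hs
      exact hN (Finset.Subset.antisymm hs (by simpa using he))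
    have hun : {e} ∪ N \ {e} = N := Finset.union_sdiff_of_subset (by simpa using he)
    obtain ⟨z, hz1, hz2⟩ := conn_touch (A := {e}) (B := N \ {e}) (by rwa [hun]) (by simp) hne
    rw [supp_loop hv, Finset.mem_singleton] at hz1
    subst hz1
    obtain ⟨f, hf, hzf⟩ := mem_supp.1 hz2
    rw [Finset.mem_sdiff, Finset.mem_singleton] at hf
    obtain ⟨y, hy⟩ := isLoop_iff.1 (hL f hf.1)
    have hzy : z = y := by rw [hy] at hzf; simpa using hzf
    subst hzy
    obtain ⟨hNe, s1, s2⟩ := hirr.loop_uniq he hf.1 hv hy (Ne.symm hf.2)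
    have hb : IsSignedCircuit ends sgn N := by
      rw [hNe, Finset.insert_eq]
      exact circuit_loop_barbell (neg_loop hv s1) (by rw [supp_loop hv]; simp) hy s2
        (by simpa using hf.2)
    refine Cov.of (C₁ := [N, N]) (C₂ := [N]) (C₃ := [N]) (by simpa using hb) (by simpa using hb)
      (by simpa using hb) ?_
    intro x hx
    simp only [widthAt_cons, widthAt_nil, hx, if_true]
    refine ⟨by omega, by omega, ?_⟩
    intros; trivial

theorem irr_tight {ends : E → Sym2 V} {sgn : E → Bool} {N : Finset E} (hirr : Irr ends sgn N)
    (he : EvenOn ends N) : Tight ends (N.filter fun e => ¬ IsLoop ends e) := by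
  set K := N.filter fun e => ¬ IsLoop ends e with hK
  intro K₁ hK₁ hne hne'
  by_contra hcon
  push Not at hcon
  have hKN : K ⊆ N := Finset.filter_subset _ _
  obtain ⟨v, hv⟩ : ∃ v, support ends K₁ ∩ support ends (K \ K₁) ⊆ {v} := by
    by_cases hem : ∃ y, y ∈ support ends K₁ ∩ support ends (K \ K₁)
    · obtain ⟨y, hy⟩ := hem
      refine ⟨y, fun z hz => ?_⟩
      rw [Finset.mem_inter] at hy hz
      rw [Finset.mem_singleton]
      by_contra hne
      exact hcon y z (Ne.symm hne) hy.1 hz.1 hy.2 hz.2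
    · obtain ⟨e, _⟩ := hne
      obtain ⟨a, _, _⟩ := exists_ends ends e
      exact ⟨a, fun z hz => absurd ⟨z, hz⟩ hem⟩
  set N₁ := N.filter fun e => e ∈ K₁ ∨ (IsLoop ends e ∧ ∃ x ∈ ends e, x ∈ support ends K₁) with hN₁
  have hN₁N : N₁ ⊆ N := Finset.filter_subset _ _
  have hK₁N₁ : K₁ ⊆ N₁ := fun e h => Finset.mem_filter.2 ⟨hKN (hK₁ h), Or.inl h⟩
  have hKN₂ : K \ K₁ ⊆ N \ N₁ := by
    intro e h
    rw [Finset.mem_sdiff] at h ⊢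
    refine ⟨hKN h.1, fun h' => ?_⟩
    rcases (Finset.mem_filter.1 h').2 with h2 | h2
    · exact h.2 h2
    · exact (Finset.mem_filter.1 h.1).2 h2.1
  have hs1 : support ends N₁ ⊆ support ends K₁ := by
    intro x hx
    obtain ⟨e, he, hxe⟩ := mem_supp.1 hx
    rcases (Finset.mem_filter.1 he).2 with h2 | ⟨h2, y, hy, hyK⟩
    · exact mem_supp.2 ⟨e, h2, hxe⟩
    · obtain ⟨z, hz⟩ := isLoop_iff.1 h2
      rw [hz] at hxe hy
      have h3 : x = z := by simpa using hxe
      have h4 : y = z := by simpa using hy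
      rw [h3, ← h4]; exact hyK
  have hs : support ends N₁ ∩ support ends (N \ N₁) ⊆ {v} := by
    intro x hx
    rw [Finset.mem_inter] at hx
    refine hv (Finset.mem_inter.2 ⟨hs1 hx.1, ?_⟩)
    obtain ⟨e, he, hxe⟩ := mem_supp.1 hx.2
    rw [Finset.mem_sdiff] at he
    have hnl : ¬ IsLoop ends e := fun hl =>
      he.2 (Finset.mem_filter.2 ⟨he.1, Or.inr ⟨hl, x, hxe, hs1 hx.1⟩⟩)
    refine mem_supp.2 ⟨e, ?_, hxe⟩
    rw [Finset.mem_sdiff]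
    exact ⟨Finset.mem_filter.2 ⟨he.1, hnl⟩, fun h => he.2 (hK₁N₁ h)⟩
  have hun : N₁ ∪ N \ N₁ = N := Finset.union_sdiff_of_subset hN₁N
  have hdj : Disjoint N₁ (N \ N₁) := Finset.disjoint_sdiff
  have he1 : EvenOn ends N₁ := split_even hdj (by rwa [hun]) hs
  have he2 : EvenOn ends (N \ N₁) := he.sdiff he1 hN₁N
  have hsmall : ∀ X : Finset E, X.card ≤ 1 → EvenOn ends X → (∃ e ∈ X, e ∈ K) → False := by
    rintro X hX hXe ⟨e, heX, heK⟩
    have : X = {e} := Finset.eq_singleton_iff_unique_mem.2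
      ⟨heX, fun y hy => Finset.card_le_one.1 hX y hy e heX⟩
    rw [this] at hXe
    exact (Finset.mem_filter.1 heK).2 (even_single hXe)
  obtain ⟨e, hee⟩ := hne
  obtain ⟨f, hf⟩ := hne'
  rcases (hirr N₁ hN₁N ⟨e, hK₁N₁ hee⟩ ⟨f, hKN₂ hf⟩ v hs).2 with h | h
  · exact hsmall _ h he1 ⟨e, hK₁N₁ hee, hK₁ hee⟩
  · exact hsmall _ h he2 ⟨f, hKN₂ hf, (Finset.mem_sdiff.1 hf).1⟩


theorem case_C {n : ℕ} (IH : Main V E n) {ends : E → Sym2 V} {sgn : E → Bool} {N : Finset E}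
    (hsz : N.card ≤ n + 1) (hc : ConnectedOn ends N) (he : EvenOn ends N)
    (hev : Even (negEdges sgn N).card) (hirr : Irr ends sgn N) : Cov ends sgn N N := by
  by_cases hL : ∀ e ∈ N, IsLoop ends e
  · exact case_loops hirr hc hev hL
  push Not at hL
  obtain ⟨k, hkN, hkl⟩ := hL
  have hT := irr_tight hirr he
  set K := N.filter fun e => ¬ IsLoop ends e with hK
  have hKN : K ⊆ N := Finset.filter_subset _ _
  have hkK : k ∈ K := Finset.mem_filter.2 ⟨hkN, hkl⟩
  have hKl : ∀ e ∈ K, ¬ IsLoop ends e := fun e h => (Finset.mem_filter.1 h).2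
  have hNK : ∀ e ∈ N, e ∉ K → IsLoop ends e := by
    intro e h1 h2
    by_contra h3
    exact h2 (Finset.mem_filter.2 ⟨h1, h3⟩)
  have hneg : ∀ e ∈ N, ∀ v, ends e = s(v, v) → sgn e = true := by
    intro e h1 v hv
    refine hirr.loop_neg h1 hv ?_
    rintro hN
    rw [hN, Finset.mem_singleton] at hkN
    subst hkN
    exact hkl (isLoop_iff.2 ⟨v, hv⟩)
  have huniq : ∀ e ∈ N, ∀ f ∈ N, ∀ v, ends e = s(v, v) → ends f = s(v, v) → e = f := by
    intro e h1 f h2 v hv hv'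
    by_contra hef
    have := (hirr.loop_uniq h1 h2 hv hv' hef).1
    rw [this, Finset.mem_insert, Finset.mem_singleton] at hkN
    rcases hkN with rfl | rfl
    · exact hkl (isLoop_iff.2 ⟨v, hv⟩)
    · exact hkl (isLoop_iff.2 ⟨v, hv'⟩)
  have hvK : ∀ e ∈ N, ∀ v, ends e = s(v, v) → v ∈ support ends K := by
    intro e h1 v hv
    have hun : {e} ∪ N \ {e} = N := Finset.union_sdiff_of_subset (by simpa using h1)
    obtain ⟨z, hz1, hz2⟩ := conn_touch (A := {e}) (B := N \ {e}) (by rwa [hun]) (by simp)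
      ⟨k, by
        rw [Finset.mem_sdiff, Finset.mem_singleton]
        refine ⟨hkN, ?_⟩
        rintro rfl
        exact hkl (isLoop_iff.2 ⟨v, hv⟩)⟩
    rw [supp_loop hv, Finset.mem_singleton] at hz1
    subst hz1
    obtain ⟨f, hf, hzf⟩ := mem_supp.1 hz2
    rw [Finset.mem_sdiff, Finset.mem_singleton] at hf
    refine mem_supp.2 ⟨f, Finset.mem_filter.2 ⟨hf.1, ?_⟩, hzf⟩
    intro hfl
    obtain ⟨y, hy⟩ := isLoop_iff.1 hfl
    have hzy : z = y := by rw [hy] at hzf; simpa using hzf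
    subst hzy
    exact hf.2 (huniq f hf.1 e h1 z hy hv)
  have hKe : EvenOn ends K := by
    have h1 : EvenOn ends (N \ K) := loops_even fun e h => by
      rw [Finset.mem_sdiff] at h; exact hNK e h.1 h.2
    have := he.sdiff h1 Finset.sdiff_subset
    rwa [Finset.sdiff_sdiff_eq_self hKN] at this
  -- loops and representatives
  have hchl : ∀ v, ∃ e, (∃ e' ∈ N, ends e' = s(v, v)) → e ∈ N ∧ ends e = s(v, v) := by
    intro v
    by_cases h : ∃ e' ∈ N, ends e' = s(v, v)
    · obtain ⟨e', h1, h2⟩ := h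
      exact ⟨e', fun _ => ⟨h1, h2⟩⟩
    · exact ⟨k, fun h' => absurd h' h⟩
  choose l hl using hchl
  have hchf : ∀ v, ∃ e, v ∈ support ends K → e ∈ K ∧ v ∈ ends e := by
    intro v
    by_cases h : v ∈ support ends K
    · obtain ⟨e, h1, h2⟩ := mem_supp.1 h
      exact ⟨e, fun _ => ⟨h1, h2⟩⟩
    · exact ⟨k, fun h' => absurd h' h⟩
  choose f hf using hchf
  set D : Finset V := Finset.univ.filter fun v =>
    (∃ e' ∈ N, ends e' = s(v, v)) ∧ degree ends K v = 2 with hD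
  have hDl : ∀ v ∈ D, l v ∈ N ∧ ends (l v) = s(v, v) := fun v h => hl v (Finset.mem_filter.1 h).2.1
  have hDf : ∀ v ∈ D, f v ∈ K ∧ v ∈ ends (f v) := by
    intro v h
    obtain ⟨e', h1, h2⟩ := (Finset.mem_filter.1 h).2.1
    exact hf v (hvK e' h1 v h2)
  obtain ⟨A, hAK, hA, hAc, hAw⟩ := claimZ
    (fun e => ((negEdges sgn {e}).card + (D.filter fun v => f v = e).card : ℕ)) ⟨k, hkK⟩ hKe hT
  set M := D.filter fun v => v ∈ support ends A with hM
  have hMD : M ⊆ D := Finset.filter_subset _ _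
  have hMl : ∀ x ∈ M, ends (l x) = s(x, x) ∧ sgn (l x) = true := fun x hx =>
    ⟨(hDl x (hMD hx)).2, hneg _ (hDl x (hMD hx)).1 x (hDl x (hMD hx)).2⟩
  have hMA : M ⊆ support ends A := fun x hx => (Finset.mem_filter.1 hx).2
  have hAl : ∀ e ∈ A, ¬ IsLoop ends e := fun e h => hKl e (hAK h)
  have hMN : M.image l ⊆ N := by
    intro e h
    obtain ⟨x, hx, rfl⟩ := Finset.mem_image.1 h
    exact (hDl x (hMD hx)).1
  have hMloop : ∀ e ∈ M.image l, IsLoop ends e := by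
    intro e h
    obtain ⟨x, hx, rfl⟩ := Finset.mem_image.1 h
    exact isLoop_iff.2 ⟨x, (hMl x hx).1⟩
  have hAM : Disjoint A (M.image l) := by
    rw [Finset.disjoint_left]
    exact fun e h1 h2 => hAl e h1 (hMloop e h2)
  have hnegA : (negEdges sgn (A ∪ M.image l)).card = (negEdges sgn A).card + M.card := by
    rw [neg_union hAM, neg_image hMl]
  have hsubN : A ∪ M.image l ⊆ N := Finset.union_subset (hAK.trans hKN) hMN
  rcases hAw with hw | hAe
  · have hMf : M = D.filter fun v => f v ∈ A := by
      apply Finset.filter_congr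
      intro v hv
      constructor
      · intro hvA
        by_contra hfA
        have h1 := degree_sdiff hAK v (ends := ends)
        rw [hA.2.2 v hvA, (Finset.mem_filter.1 hv).2.2] at h1
        have h2 : degree ends (K \ A) v = 0 := by omega
        exact degree_zero.1 h2 (mem_supp.2 ⟨f v, Finset.mem_sdiff.2 ⟨(hDf v hv).1, hfA⟩, (hDf v hv).2⟩)
      · intro h
        exact mem_supp.2 ⟨f v, h, (hDf v hv).2⟩
    have hMc : M.card = ∑ e ∈ A, (D.filter fun v => f v = e).card := by
      rw [hMf]
      refine (Finset.card_eq_sum_card_fiberwise (f := f) (s := D.filter fun v => f v ∈ A) (t := A)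
        (fun v hv => (Finset.mem_filter.1 hv).2)).trans ?_
      refine Finset.sum_congr rfl fun e heA => ?_
      congr 1
      ext v
      simp only [Finset.mem_filter]
      constructor
      · rintro ⟨⟨h1, _⟩, h2⟩; exact ⟨h1, h2⟩
      · rintro ⟨h1, h2⟩; exact ⟨⟨h1, by rw [h2]; exact heA⟩, h2⟩
    have hAn : (negEdges sgn A).card = ∑ e ∈ A, (negEdges sgn {e}).card := by
      simp only [neg_single]
      rw [negEdges, Finset.card_filter]
    have hpar : Even ((negEdges sgn A).card + M.card) := by
      rw [hMc, hAn, ← Finset.sum_add_distrib]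
      rw [← Nat.cast_sum] at hw
      exact (ZMod.natCast_eq_zero_iff_even).1 hw
    have hcov := direct hA hAl hMA hMl hpar
    set N' := N \ (A ∪ M.image l) with hN'
    have hN'e : N' = (K \ A) ∪ ((N \ K) \ M.image l) := by
      ext e
      have a1 : e ∈ M.image l → e ∉ K := fun h h' => hKl e h' (hMloop e h)
      have a2 : e ∈ K → e ∈ N := fun h => hKN h
      have a3 : e ∈ A → e ∈ K := fun h => hAK h
      simp only [hN', Finset.mem_sdiff, Finset.mem_union]
      tauto
    have hN'c : ConnectedOn ends N' := by
      rw [hN'e]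
      refine conn_loops hAc ?_
      intro e heL
      rw [Finset.mem_sdiff, Finset.mem_sdiff] at heL
      obtain ⟨⟨h1, h2⟩, h3⟩ := heL
      obtain ⟨v, hv⟩ := isLoop_iff.1 (hNK e h1 h2)
      refine ⟨v, ?_, hv⟩
      by_contra hcon
      have hvk := hvK e h1 v hv
      have h4 := degree_sdiff hAK v (ends := ends)
      rw [degree_zero.2 hcon, zero_add] at h4
      have h5 : v ∈ support ends A := by
        by_contra h6
        rw [degree_zero.2 h6] at h4
        exact degree_zero.1 h4.symm hvk
      have h7 : v ∈ D := Finset.mem_filter.2 ⟨Finset.mem_univ _, ⟨e, h1, hv⟩, by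
        rw [← h4]; exact hA.2.2 v h5⟩
      apply h3
      refine Finset.mem_image.2 ⟨v, Finset.mem_filter.2 ⟨h7, h5⟩, ?_⟩
      exact huniq _ (hDl v h7).1 _ h1 v (hDl v h7).2 hv
    have hN'even : EvenOn ends N' := by
      refine he.sdiff ?_ hsubN
      intro v
      rw [degree_union hAM]
      exact (hA.evenOn v).add (loops_even hMloop v)
    have hdj : Disjoint (A ∪ M.image l) N' := Finset.disjoint_sdiff
    have hun : (A ∪ M.image l) ∪ N' = N := Finset.union_sdiff_of_subset hsubN
    have hN'p : Even (negEdges sgn N').card := by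
      rw [← hun, neg_union hdj, hnegA] at hev
      exact (Nat.even_add.1 hev).1 hpar
    have hcard : N'.card ≤ n := by
      have h1 : (A ∪ M.image l).card + N'.card = N.card := by
        rw [← Finset.card_union_of_disjoint hdj, hun]
      have h2 : 0 < (A ∪ M.image l).card := Finset.card_pos.2 (hA.1.mono Finset.subset_union_left)
      omega
    have hcov2 := IH ends sgn N' ∅ (by simpa using hcard) (by simp) (by simpa using hN'c) hN'even hN'p
    rw [Finset.union_empty] at hcov2
    have := Cov.combine hcov hcov2 hdj (Finset.Subset.refl _) (Finset.Subset.refl _)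
    rwa [hun] at this
  · have hNe : A ∪ M.image l = N := by
      refine Finset.Subset.antisymm hsubN ?_
      intro e heN
      rw [Finset.mem_union]
      by_cases heK : e ∈ K
      · left; rw [hAe]; exact heK
      · right
        obtain ⟨v, hv⟩ := isLoop_iff.1 (hNK e heN heK)
        have hvk := hvK e heN v hv
        have hvA : v ∈ support ends A := by rw [hAe]; exact hvk
        have h7 : v ∈ D := Finset.mem_filter.2 ⟨Finset.mem_univ _, ⟨e, heN, hv⟩, by
          have := hA.2.2 v hvA
          rwa [hAe] at this⟩
        refine Finset.mem_image.2 ⟨v, Finset.mem_filter.2 ⟨h7, hvA⟩, ?_⟩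
        exact huniq _ (hDl v h7).1 _ heN v (hDl v h7).2 hv
    have := direct hA hAl hMA hMl (by rw [← hnegA, hNe]; exact hev)
    rwa [hNe] at this

theorem main_all (n : ℕ) : Main V E n := by
  induction n with
  | zero =>
    intro ends sgn N P hsz _ _ _ _
    have h1 : N = ∅ := Finset.card_eq_zero.1 (by omega)
    have h2 : P = ∅ := Finset.card_eq_zero.1 (by omega)
    rw [h1, h2, Finset.union_empty]
    exact cov_empty
  | succ n IH =>
    intro ends sgn N P hsz hd hc he hev
    by_cases hP : P.Nonempty
    · exact case_A IH hsz hd hc he hev hP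
    rw [Finset.not_nonempty_iff_eq_empty] at hP
    subst hP
    rw [Finset.union_empty] at hc ⊢
    rw [Finset.card_empty, add_zero] at hsz
    by_cases hirr : Irr ends sgn N
    · exact case_C IH hsz hc he hev hirr
    unfold Irr at hirr
    push Not at hirr
    obtain ⟨N₁, hs, h1, h2, v, hv, hb⟩ := hirr
    have hun : N₁ ∪ N \ N₁ = N := Finset.union_sdiff_of_subset hs
    have := case_B IH (N₁ := N₁) (N₂ := N \ N₁) (sgn := sgn) (by rwa [hun]) Finset.disjoint_sdiff
      (by rwa [hun]) (by rwa [hun]) (by rwa [hun]) h1 h2 hv (by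
        by_cases hh : Even (negEdges sgn N₁).card
        · exact Or.inl hh
        · right
          exact hb hh)
    rwa [hun] at this

theorem final (ends : E → Sym2 V) (sgn : E → Bool)
    (hte : IsTreeOfEulerian ends)
    (heven : Even (negEdges sgn (nonbridges ends)).card) :
    ∃ 𝒞₁ 𝒞₂ 𝒞₃ : List (Finset E),
      (∀ C ∈ 𝒞₁, IsSignedCircuit ends sgn C) ∧
      (∀ C ∈ 𝒞₂, IsSignedCircuit ends sgn C) ∧
      (∀ C ∈ 𝒞₃, IsSignedCircuit ends sgn C) ∧
      (∀ e : E, ¬ IsBridgeIn ends Finset.univ e → ∃ C ∈ 𝒞₁, e ∈ C) ∧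
      (∀ e : E, ¬ IsBridgeIn ends Finset.univ e → ∃ C ∈ 𝒞₂, e ∈ C) ∧
      (∀ e : E, ¬ IsBridgeIn ends Finset.univ e → ∃ C ∈ 𝒞₃, e ∈ C) ∧
      (∀ e : E, widthAt 𝒞₁ e ≤ 2 ∧ widthAt 𝒞₂ e ≤ 2 ∧ widthAt 𝒞₃ e ≤ 2) ∧
      (∀ e : E, widthAt 𝒞₁ e + widthAt 𝒞₂ e + widthAt 𝒞₃ e ≤ 4) ∧
      (∀ e : E, IsLoop ends e → sgn e = true → widthAt 𝒞₁ e = 2) := by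
  have hun : nonbridges ends ∪ bridges ends = Finset.univ :=
    Finset.sdiff_union_of_subset (Finset.subset_univ _)
  obtain ⟨C₁, C₂, C₃, h1, h2, h3, h4, h5, h6⟩ := main_all _ ends sgn (nonbridges ends) (bridges ends)
    le_rfl Finset.sdiff_disjoint (by rw [hun]; intro u _ v _; exact hte.1 u v) hte.2 heven
  have hmem : ∀ e, ¬ IsBridgeIn ends Finset.univ e → e ∈ nonbridges ends := by
    intro e h
    simp [nonbridges, bridges, h]
  refine ⟨C₁, C₂, C₃, fun C h => (h1 C h).1, fun C h => (h2 C h).1, fun C h => (h3 C h).1,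
    fun e h => widthAt_pos (h4 e (hmem e h)).1, fun e h => widthAt_pos (h4 e (hmem e h)).2.1,
    fun e h => widthAt_pos (h4 e (hmem e h)).2.2,
    fun e => ⟨(h5 e).1, (h5 e).2.1, (h5 e).2.2.1⟩, fun e => (h5 e).2.2.2, ?_⟩
  intro e hl hs
  refine h6 e (hmem e ?_) hl hs
  rintro ⟨_, hb⟩
  obtain ⟨v, hv⟩ := isLoop_iff.1 hl
  exact hb v v hv Relation.ReflTransGen.refl

/-- A tree of Eulerian graphs with an even number of negative
non-bridge edges has three weak signed circuit covers of total width at most 4,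
each of width at most 2, the first covering every negative loop exactly twice. -/
theorem statement6 {V E : Type} [Fintype V] [Fintype E] [DecidableEq V] [DecidableEq E]
    (ends : E → Sym2 V) (sgn : E → Bool)
    (hte : IsTreeOfEulerian ends)
    (heven : Even (negEdges sgn (nonbridges ends)).card) :
    ∃ 𝒞₁ 𝒞₂ 𝒞₃ : List (Finset E),
      (∀ C ∈ 𝒞₁, IsSignedCircuit ends sgn C) ∧
      (∀ C ∈ 𝒞₂, IsSignedCircuit ends sgn C) ∧
      (∀ C ∈ 𝒞₃, IsSignedCircuit ends sgn C) ∧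
      (∀ e : E, ¬ IsBridgeIn ends Finset.univ e → ∃ C ∈ 𝒞₁, e ∈ C) ∧
      (∀ e : E, ¬ IsBridgeIn ends Finset.univ e → ∃ C ∈ 𝒞₂, e ∈ C) ∧
      (∀ e : E, ¬ IsBridgeIn ends Finset.univ e → ∃ C ∈ 𝒞₃, e ∈ C) ∧
      (∀ e : E, widthAt 𝒞₁ e ≤ 2 ∧ widthAt 𝒞₂ e ≤ 2 ∧ widthAt 𝒞₃ e ≤ 2) ∧
      (∀ e : E, widthAt 𝒞₁ e + widthAt 𝒞₂ e + widthAt 𝒞₃ e ≤ 4) ∧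
      (∀ e : E, IsLoop ends e → sgn e = true → widthAt 𝒞₁ e = 2) :=
  final ends sgn hte heven

end SignedCircuitCover
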